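/- Let n ≥ 3. There exist a maximal subgroup M of PSL(n,ℤ) of infinite index and an element g ∈ PSL(n,ℤ) such that M ∩ gMg⁻¹ = {id}. -/

import Mathlib

/- Common setup: `SL(n,ℤ)`, `SL(n,ℝ)`, the real projective space `ℙ^{n-1}(ℝ)`
with its quotient topology and the projective action, rank-1 unipotent elements
and their attracting points / fixed hyperplanes, metrics compatible with the
topology of `ℙ`, `ε`-neighbourhoods, Schottky systems, profinite density,
maximal subgroups, and lattices in `SL(n,ℝ)`. -/

open Matrix LinearAlgebra.Projectivization

abbrev SLZ (n : ℕ) := Matrix.SpecialLinearGroup (Fin n) ℤ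

abbrev SLR (n : ℕ) := Matrix.SpecialLinearGroup (Fin n) ℝ

/-- The real projective space `ℙ^{n-1}(ℝ)`: the projectivization of `ℝⁿ`. -/
abbrev Proj (n : ℕ) := Projectivization ℝ (Fin n → ℝ)

/-- The quotient topology on `ℙ^{n-1}(ℝ)`. -/
noncomputable instance (n : ℕ) : TopologicalSpace (Proj n) :=
  inferInstanceAs (TopologicalSpace (Quotient _))

/-- The action of `SL(n,ℝ)` on `ℙ^{n-1}(ℝ)` induced by the linear action on `ℝⁿ`. -/
noncomputable def actR {n : ℕ} (g : SLR n) (x : Proj n) : Proj n :=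
  Projectivization.map (Matrix.SpecialLinearGroup.toLin' g).toLinearMap
    (Matrix.SpecialLinearGroup.toLin' g).injective x

/-- The action of `SL(n,ℤ)` on `ℙ^{n-1}(ℝ)` induced by the linear action on `ℝⁿ`. -/
noncomputable def act {n : ℕ} (g : SLZ n) (x : Proj n) : Proj n :=
  actR (Matrix.SpecialLinearGroup.map (Int.castRingHom ℝ) g) x

/-- The real matrix attached to `g ∈ SL(n,ℤ)`. -/
noncomputable def matR {n : ℕ} (g : SLZ n) : Matrix (Fin n) (Fin n) ℝ :=
  ((Matrix.SpecialLinearGroup.map (Int.castRingHom ℝ)) g : Matrix (Fin n) (Fin n) ℝ)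

/-- The subspace `Im(u - I) ⊆ ℝⁿ` (a line when `u` is rank-1 unipotent). -/
noncomputable def lineOf {n : ℕ} (u : SLZ n) : Submodule ℝ (Fin n → ℝ) :=
  LinearMap.range (Matrix.mulVecLin (matR u - 1))

/-- The subspace `ker(u - I) ⊆ ℝⁿ` (a hyperplane when `u` is rank-1 unipotent). -/
noncomputable def hypOf {n : ℕ} (u : SLZ n) : Submodule ℝ (Fin n → ℝ) :=
  LinearMap.ker (Matrix.mulVecLin (matR u - 1))

/-- The rational matrix attached to `g ∈ SL(n,ℤ)`. -/
noncomputable def matQ {n : ℕ} (g : SLZ n) : Matrix (Fin n) (Fin n) ℚ :=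
  ((Matrix.SpecialLinearGroup.map (Int.castRingHom ℚ)) g : Matrix (Fin n) (Fin n) ℚ)

/-- `g - I`, as a `ℚ`-linear endomorphism of `ℚⁿ`. -/
noncomputable def linQ {n : ℕ} (g : SLZ n) : (Fin n → ℚ) →ₗ[ℚ] (Fin n → ℚ) :=
  Matrix.mulVecLin (matQ g - 1)

/-- `u` is a rank-1 unipotent element of `SL(n,ℤ)`: `u - I` is nilpotent of rank one. -/
def IsR1U {n : ℕ} (u : SLZ n) : Prop :=
  IsNilpotent (linQ u) ∧ Module.finrank ℚ (LinearMap.range (linQ u)) = 1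

/-- The point of attraction `p_u` of `u`, as a subset of `ℙ` (a singleton when `u` is a
rank-1 unipotent): the projective points whose representative spans `Im(u - I)`. -/
def attSet {n : ℕ} (u : SLZ n) : Set (Proj n) :=
  {x | x.submodule = lineOf u}

/-- The fixed hyperplane `L_u` of `u`, as a subset of `ℙ`. -/
def fixSet {n : ℕ} (u : SLZ n) : Set (Proj n) :=
  {x | x.submodule ≤ hypOf u}

/-- The subset of `ℙ` corresponding to a linear subspace `W ⊆ ℝⁿ`. -/
def projSet {n : ℕ} (W : Submodule ℝ (Fin n → ℝ)) : Set (Proj n) :=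
  {x | x.submodule ≤ W}

/-- The image `g • W` of a subspace of `ℝⁿ` under `g ∈ SL(n,ℤ)`. -/
noncomputable def actSub {n : ℕ} (g : SLZ n) (W : Submodule ℝ (Fin n → ℝ)) :
    Submodule ℝ (Fin n → ℝ) :=
  Submodule.map (Matrix.mulVecLin (matR g)) W

/-- The image `g • W` of a subspace of `ℝⁿ` under `g ∈ SL(n,ℝ)`. -/
noncomputable def actSubR {n : ℕ} (g : SLR n) (W : Submodule ℝ (Fin n → ℝ)) :
    Submodule ℝ (Fin n → ℝ) :=
  Submodule.map (Matrix.mulVecLin (g : Matrix (Fin n) (Fin n) ℝ)) W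

/-- `d` is a metric on `ℙ^{n-1}(ℝ)` inducing the quotient topology. -/
structure IsCompatMetric {n : ℕ} (d : Proj n → Proj n → ℝ) : Prop where
  self : ∀ x, d x x = 0
  eq_of : ∀ x y, d x y = 0 → x = y
  symm : ∀ x y, d x y = d y x
  triangle : ∀ x y z, d x z ≤ d x y + d y z
  inducing : ∀ s : Set (Proj n), IsOpen s ↔ ∀ x ∈ s, ∃ ε > 0, ∀ y, d x y < ε → y ∈ s

/-- The distance from a point to a set. -/
noncomputable def setDist {n : ℕ} (d : Proj n → Proj n → ℝ) (x : Proj n)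
    (A : Set (Proj n)) : ℝ :=
  sInf (d x '' A)

/-- The open `ε`-neighbourhood `(A)_ε = {x | dist(x, A) < ε}`. -/
def oThick {n : ℕ} (d : Proj n → Proj n → ℝ) (A : Set (Proj n)) (ε : ℝ) : Set (Proj n) :=
  {x | setDist d x A < ε}

/-- The closed `ε`-neighbourhood `[A]_ε = {x | dist(x, A) ≤ ε}`. -/
def cThick {n : ℕ} (d : Proj n → Proj n → ℝ) (A : Set (Proj n)) (ε : ℝ) : Set (Proj n) :=
  {x | setDist d x A ≤ ε}

/-- The Hausdorff distance between two subsets of `ℙ`. -/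
noncomputable def hDist {n : ℕ} (d : Proj n → Proj n → ℝ) (A B : Set (Proj n)) : ℝ :=
  max (sSup ((fun a => setDist d a B) '' A)) (sSup ((fun b => setDist d b A) '' B))

/-- A rational point of `ℙ`: one spanned by a vector of `ℚⁿ`. -/
def RatPoint {n : ℕ} (p : Proj n) : Prop :=
  ∃ v : Fin n → ℚ, p.submodule = Submodule.span ℝ {fun i => ((v i : ℝ))}

/-- A subspace of `ℝⁿ` spanned by vectors of `ℚⁿ`. -/
def IsRatSubmodule {n : ℕ} (W : Submodule ℝ (Fin n → ℝ)) : Prop :=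
  ∃ T : Set (Fin n → ℚ),
    W = Submodule.span ℝ ((fun (v : Fin n → ℚ) (i : Fin n) => ((v i : ℝ))) '' T)

/-- A Schottky system `(S, 𝒜, ℛ)` with respect to the metric `d`: `S` is a nonempty
set of rank-1 unipotents, `𝒜 ⊆ ℛ` are closed, and for each `u ∈ S` there are
`δ_u ≥ ε_u > 0` satisfying the ping-pong conditions. -/
structure IsSchottky {n : ℕ} (d : Proj n → Proj n → ℝ) (S : Set (SLZ n))
    (A R : Set (Proj n)) : Prop where
  nonempty : S.Nonempty
  unip : ∀ u ∈ S, IsR1U u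
  AsubR : A ⊆ R
  closedA : IsClosed A
  closedR : IsClosed R
  cond : ∃ ε δ : SLZ n → ℝ, (∀ u ∈ S, 0 < ε u ∧ ε u ≤ δ u) ∧
    (∀ u ∈ S, ∀ k : ℤ, k ≠ 0 → ∀ x, x ∉ oThick d (fixSet u) (δ u) →
      act (u ^ k) x ∈ oThick d (attSet u) (ε u)) ∧
    (∀ u ∈ S, ∀ v ∈ S, u ≠ v → oThick d (attSet u) (ε u) ∩ oThick d (fixSet v) (δ v) = ∅) ∧
    (∀ u ∈ S, oThick d (attSet u) (ε u) ⊆ A) ∧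
    (∀ u ∈ S, oThick d (fixSet u) (δ u) ⊆ R)

/-- `H` is profinitely dense in `G`: `HN = G` for every finite-index normal `N ⊴ G`. -/
def ProfinitelyDense {G : Type*} [Group G] (H : Subgroup G) : Prop :=
  ∀ N : Subgroup G, N.Normal → N.FiniteIndex → H ⊔ N = ⊤

/-- `M` is a maximal (proper) subgroup of `G`. -/
def IsMaxSubgroup {G : Type*} [Group G] (M : Subgroup G) : Prop :=
  M ≠ ⊤ ∧ ∀ K : Subgroup G, M < K → K = ⊤

noncomputable instance (n : ℕ) : TopologicalSpace (SLR n) :=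
  inferInstanceAs (TopologicalSpace {A : Matrix (Fin n) (Fin n) ℝ // A.det = 1})

noncomputable instance (n : ℕ) : MeasurableSpace (SLR n) := borel _

/-- `Γ ≤ SL(n,ℝ)` is a lattice: a discrete subgroup admitting a Borel fundamental
domain of finite Haar measure. -/
def IsLatticeIn {n : ℕ} (Γ : Subgroup (SLR n)) : Prop :=
  DiscreteTopology Γ ∧
  ∃ μ : MeasureTheory.Measure (SLR n), μ.IsHaarMeasure ∧
    ∃ D : Set (SLR n), MeasurableSet D ∧ μ D < ⊤ ∧
      ∀ g : SLR n, ∃! γ : Γ, (γ : SLR n)⁻¹ * g ∈ D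

abbrev PSLZ (n : ℕ) := SLZ n ⧸ Subgroup.center (SLZ n)

namespace PingPong

variable {n : ℕ}

/-- Reduced words in two families of group elements applied to a base point; the index records
the family used last, and only letters which move the current point are recorded. -/
inductive Reach {G X : Type*} [Group G] (f : G → X → X) (H : Bool → Subgroup G) (x : X) :
    Option Bool → X → Prop
  | base : Reach f H x none x
  | step (b : Bool) (o : Option Bool) (y : X) (h : G) : Reach f H x o y → o ≠ some b → h ∈ H b →
      f h y ≠ y → Reach f H x (some b) (f h y)

theorem Reach.mem {G X : Type*} [Group G] {f : G → X → X} {H : Bool → Subgroup G} {x : X}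
    {Z : Bool → Set X} (hZ : ∀ b y, y = x ∨ y ∈ Z (!b) → ∀ h ∈ H b, f h y = y ∨ f h y ∈ Z b)
    {o : Option Bool} {y : X} (hy : Reach f H x o y) :
    (o = none → y = x) ∧ ∀ b, o = some b → y ∈ Z b := by
  induction hy with
  | base => simp
  | step b o y h hr ho hh hne ih =>
    refine ⟨by simp, ?_⟩
    intro b' hb'
    obtain rfl : b = b' := by simpa using hb'
    have hy' : y = x ∨ y ∈ Z (!b) := by
      cases o with
      | none => exact Or.inl (ih.1 rfl)
      | some b' => exact Or.inr (ih.2 _ (by cases b <;> cases b' <;> simp_all))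
    exact (hZ b y hy' h hh).resolve_left hne

theorem Reach.smul {G X : Type*} [Group G] {f : G → X → X} {H : Bool → Subgroup G} {x : X}
    (hmul : ∀ g h y, f (g * h) y = f g (f h y))
    {o : Option Bool} {y : X} (hy : Reach f H x o y) (b : Bool) (h : G) (hh : h ∈ H b) :
    ∃ o', Reach f H x o' (f h y) := by
  by_cases hne : f h y = y
  · exact ⟨o, by rwa [hne]⟩
  by_cases ho : o = some b
  · subst ho
    cases hy with
    | step _ o' z k hr ho' hk hne' =>
      rw [← hmul]
      by_cases h2 : f (h * k) z = z
      · exact ⟨o', by rwa [h2]⟩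
      · exact ⟨_, Reach.step b o' z _ hr ho' (mul_mem hh hk) h2⟩
  · exact ⟨_, Reach.step b o y h hy ho hh hne⟩

theorem ping_pong {G X : Type*} [Group G] {f : G → X → X} (hone : ∀ y, f 1 y = y)
    (hmul : ∀ g h y, f (g * h) y = f g (f h y)) (A C : Subgroup G) (Y U : Set X) (x : X)
    (hA : ∀ y, y = x ∨ y ∈ U → ∀ h ∈ A, f h y = y ∨ f h y ∈ Y)
    (hC : ∀ y, y = x ∨ y ∈ Y → ∀ h ∈ C, f h y = y ∨ f h y ∈ U)
    (g : G) (hg : g ∈ A ⊔ C) : f g x = x ∨ f g x ∈ Y ∪ U := by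
  let H : Bool → Subgroup G := fun b => if b then A else C
  let Z : Bool → Set X := fun b => if b then Y else U
  have hZ : ∀ b y, y = x ∨ y ∈ Z (!b) → ∀ h ∈ H b, f h y = y ∨ f h y ∈ Z b := by
    intro b
    cases b
    · simpa [H, Z] using hC
    · simpa [H, Z] using hA
  have key : ∀ g ∈ A ⊔ C, (∀ y o, Reach f H x o y → ∃ o', Reach f H x o' (f g y)) ∧
      ∀ y o, Reach f H x o y → ∃ o', Reach f H x o' (f g⁻¹ y) := by
    intro g hg
    rw [Subgroup.sup_eq_closure] at hg
    induction hg using Subgroup.closure_induction with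
    | mem k hk =>
      rcases hk with hk | hk
      · exact ⟨fun y o hy => hy.smul hmul true k (by simpa [H] using hk),
          fun y o hy => hy.smul hmul true k⁻¹ (by simpa [H] using hk)⟩
      · exact ⟨fun y o hy => hy.smul hmul false k (by simpa [H] using hk),
          fun y o hy => hy.smul hmul false k⁻¹ (by simpa [H] using hk)⟩
    | one => exact ⟨fun y o hy => ⟨o, by rwa [hone]⟩, fun y o hy => ⟨o, by rwa [inv_one, hone]⟩⟩
    | mul a b _ _ iha ihb =>
      constructor
      · intro y o hy
        obtain ⟨o', h'⟩ := ihb.1 y o hy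
        obtain ⟨o'', h''⟩ := iha.1 _ o' h'
        exact ⟨o'', by rwa [hmul]⟩
      · intro y o hy
        obtain ⟨o', h'⟩ := iha.2 y o hy
        obtain ⟨o'', h''⟩ := ihb.2 _ o' h'
        exact ⟨o'', by rwa [_root_.mul_inv_rev, hmul]⟩
    | inv a ha iha => exact ⟨iha.2, by rw [inv_inv]; exact iha.1⟩
  obtain ⟨o, ho⟩ := (key g hg).1 x none Reach.base
  have := ho.mem hZ
  cases o with
  | none => exact Or.inl (this.1 rfl)
  | some b =>
    right
    have h2 := this.2 b rfl
    cases b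
    · exact Or.inr h2
    · exact Or.inl h2

/-- Nonzero vectors close to a coordinate axis. -/
def nearAxis (n : ℕ) (η : ℝ) : Set (Fin n → ℝ) := {x | ∃ r, x r ≠ 0 ∧ ∀ q ≠ r, |x q| ≤ η * |x r|}

/-- Linear forms with one small coefficient, the others being of size comparable to one. -/
def Allowed (c η : ℝ) (φ : Fin n → ℝ) : Prop := ∃ r, |φ r| ≤ η ∧ ∀ q ≠ r, c ≤ |φ q| ∧ |φ q| ≤ 1

/-- The invariant kept along the construction: `A` moves the vectors near the axes into `Y`, and
`Y` stays away from the kernels of the allowed linear forms. -/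
structure Inv (c : ℝ) (A : Subgroup (SLZ n)) (Y : Set (Fin n → ℝ)) (η κ : ℝ) : Prop where
  eta_pos : 0 < η
  eta_le : η ≤ 1 / 2
  kappa_pos : 0 < κ
  move : ∀ a ∈ A, ∀ x ∈ nearAxis n η, matR a *ᵥ x = x ∨ matR a *ᵥ x ∈ Y
  far : ∀ φ, Allowed c η φ → ∀ y ∈ Y, κ * ‖y‖ ≤ |φ ⬝ᵥ y|
  sub : Y ⊆ nearAxis n (1 / 2)

theorem matR_one : matR (1 : SLZ n) = 1 := by simp [matR]

theorem matR_mul (g h : SLZ n) : matR (g * h) = matR g * matR h := by simp [matR]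

theorem nearAxis_mono {η η' : ℝ} (h : η ≤ η') : nearAxis n η ⊆ nearAxis n η' := by
  rintro x ⟨r, h0, hr⟩
  exact ⟨r, h0, fun q hq => (hr q hq).trans (by gcongr)⟩

theorem norm_eq_of_le {x : Fin n → ℝ} {r : Fin n} (h : ∀ q, |x q| ≤ |x r|) : ‖x‖ = |x r| :=
  le_antisymm ((pi_norm_le_iff_of_nonneg (abs_nonneg _)).2 h) (norm_le_pi_norm x r)

theorem norm_eq_of_nearAxis {x : Fin n → ℝ} {r : Fin n} {η : ℝ} (hη : η ≤ 1)
    (h : ∀ q ≠ r, |x q| ≤ η * |x r|) : ‖x‖ = |x r| := by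
  refine norm_eq_of_le fun q => ?_
  by_cases hq : q = r
  · rw [hq]
  · exact (h q hq).trans (by nlinarith [abs_nonneg (x r)])

theorem abs_dotProduct_le {φ x : Fin n → ℝ} {b : ℝ} (h : ∀ q, |φ q * x q| ≤ b) :
    |φ ⬝ᵥ x| ≤ n * b := by
  refine (Finset.abs_sum_le_sum_abs _ _).trans ?_
  refine (Finset.sum_le_sum fun q _ => h q).trans ?_
  simp

/-- The axis-perturbed direction `e_r + θ e_{r'}`. -/
def tilt (r r' : Fin n) (θ : ℝ) : Fin n → ℝ := fun q => (if q = r then 1 else 0) +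
  if q = r' then θ else 0

theorem dotProduct_tilt (φ : Fin n → ℝ) (r r' : Fin n) (θ : ℝ) :
    φ ⬝ᵥ tilt r r' θ = φ r + θ * φ r' := by
  simp [tilt, dotProduct, mul_add, Finset.sum_add_distrib, mul_comm]

/-- A conical neighbourhood of the direction `e_r + θ e_{r'}`. -/
def cone (r r' : Fin n) (θ α : ℝ) : Set (Fin n → ℝ) :=
  {x | x r ≠ 0 ∧ ∀ q, |x q - x r * tilt r r' θ q| ≤ α * |x r|}

theorem cone_near {r r' : Fin n} {θ α : ℝ} (hθ : 0 ≤ θ) {x : Fin n → ℝ}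
    (hx : x ∈ cone r r' θ α) (q : Fin n) (hq : q ≠ r) : |x q| ≤ (θ + α) * |x r| := by
  have h1 := hx.2 q
  have h2 : |x r * tilt r r' θ q| ≤ θ * |x r| := by
    rw [abs_mul, mul_comm]
    gcongr
    simp only [tilt, hq, if_false, zero_add]
    split_ifs <;> simp [abs_of_nonneg hθ, hθ]
  calc |x q| = |(x q - x r * tilt r r' θ q) + x r * tilt r r' θ q| := by ring_nf
    _ ≤ _ := abs_add_le _ _
    _ ≤ _ := by linarith

theorem dot_cone {r r' : Fin n} {θ α : ℝ} {x φ : Fin n → ℝ}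
    (hx : x ∈ cone r r' θ α) (hφ : ∀ q, |φ q| ≤ 1) :
    (|φ r + θ * φ r'| - n * α) * |x r| ≤ |φ ⬝ᵥ x| := by
  have h1 : φ ⬝ᵥ x = x r * (φ r + θ * φ r') + φ ⬝ᵥ (x - x r • tilt r r' θ) := by
    rw [dotProduct_sub, dotProduct_smul, dotProduct_tilt]; simp
  have h2 : |φ ⬝ᵥ (x - x r • tilt r r' θ)| ≤ n * (α * |x r|) := by
    refine abs_dotProduct_le fun q => ?_
    rw [abs_mul]
    have := hx.2 q
    have h3 := hφ q
    simp only [Pi.sub_apply, Pi.smul_apply, smul_eq_mul]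
    calc _ ≤ 1 * |x q - x r * tilt r r' θ q| := by gcongr
      _ ≤ _ := by linarith
  rw [h1]
  have h3 := abs_sub_abs_le_abs_sub (x r * (φ r + θ * φ r')) (-(φ ⬝ᵥ (x - x r • tilt r r' θ)))
  rw [abs_neg, sub_neg_eq_add, abs_mul] at h3
  nlinarith

theorem cone_far {c θ α η : ℝ} {r r' : Fin n} (hrr : r ≠ r') (hθ : 0 < θ)
    (hc1 : c ≤ 1) (hθc : θ ≤ c / 8) (hη : η ≤ c * θ / 8) (hα : n * α ≤ c * θ / 8)
    {x φ : Fin n → ℝ} (hx : x ∈ cone r r' θ α) (hφ : Allowed c η φ) :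
    c * θ / 2 * |x r| ≤ |φ ⬝ᵥ x| := by
  obtain ⟨r0, h0, h1⟩ := hφ
  have hcθ : c * θ ≤ 1 / 8 := by nlinarith
  have hle : ∀ q, |φ q| ≤ 1 := by
    intro q
    by_cases hq : q = r0
    · rw [hq]; nlinarith
    · exact (h1 q hq).2
  have key := dot_cone hx hle
  have h2 : c * θ / 2 + c * θ / 8 ≤ |φ r + θ * φ r'| := by
    by_cases hr0 : r0 = r
    · subst hr0
      have h3 := (h1 r' hrr.symm).1
      have h4 := abs_sub_abs_le_abs_add (θ * φ r') (φ r0)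
      rw [abs_mul, abs_of_pos hθ, add_comm] at h4
      nlinarith
    · have h3 := (h1 r (Ne.symm hr0)).1
      have h4 := abs_sub_abs_le_abs_add (φ r) (θ * φ r')
      rw [abs_mul, abs_of_pos hθ] at h4
      nlinarith [hle r']
  refine le_trans ?_ key
  gcongr
  linarith

theorem transvection_form {c θ α : ℝ} {r r' : Fin n} (hrr : r ≠ r') (hθ : 0 < θ)
    (hc1 : c ≤ 1) (hθc : θ ≤ c / 8) (hα : n * α ≤ c * θ / 8) {v φ : Fin n → ℝ} (hv : v r = 1)
    (hvp : ∀ q, |v q - tilt r r' θ q| ≤ α / 2) (hα0 : 0 ≤ α)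
    (hφv : φ ⬝ᵥ v = 0) (hφ : ∀ q ≠ r, c ≤ |φ q| ∧ |φ q| ≤ 1) :
    |φ r| ≤ 2 * θ ∧ c * θ / 2 ≤ |φ r| := by
  have h1 : φ r + θ * φ r' = φ ⬝ᵥ (tilt r r' θ - v) := by
    rw [dotProduct_sub, hφv, dotProduct_tilt, sub_zero]
  have h2 : |φ ⬝ᵥ (tilt r r' θ - v)| ≤ n * (α / 2) := by
    refine abs_dotProduct_le fun q => ?_
    by_cases hq : q = r
    · subst hq
      simp only [Pi.sub_apply, hv, tilt, hrr, if_true, if_false, add_zero, sub_self, mul_zero,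
        abs_zero]; positivity
    · rw [abs_mul]
      calc _ ≤ 1 * |(tilt r r' θ - v) q| := by gcongr; exact (hφ q hq).2
        _ = |v q - tilt r r' θ q| := by rw [one_mul, Pi.sub_apply, abs_sub_comm]
        _ ≤ _ := hvp q
  rw [← h1] at h2
  have h3 := hφ r' hrr.symm
  have h4 : |φ r| = |(φ r + θ * φ r') - θ * φ r'| := by ring_nf
  have h5 : |θ * φ r'| = θ * |φ r'| := by rw [abs_mul, abs_of_pos hθ]
  constructor
  · rw [h4]
    refine (abs_sub _ _).trans ?_
    nlinarith
  · rw [h4]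
    have := abs_sub_abs_le_abs_sub (θ * φ r') (φ r + θ * φ r')
    rw [abs_sub_comm, h5] at this
    nlinarith

theorem form_near {c θ α : ℝ} {r : Fin n} (hθ : 0 < θ) (hc : 0 < c)
    (hc1 : c ≤ 1) (hθc : θ ≤ c / 8) (hα : n * α ≤ c * θ / 8) (hα0 : 0 ≤ α) {φ : Fin n → ℝ}
    (hφ : ∀ q ≠ r, c ≤ |φ q| ∧ |φ q| ≤ 1) (h1 : |φ r| ≤ 2 * θ) (h2 : c * θ / 2 ≤ |φ r|)
    (hα1 : α ≤ 1)
    {x : Fin n → ℝ} (hx : x ∈ nearAxis n α) : c * θ / 4 * ‖x‖ ≤ |φ ⬝ᵥ x| := by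
  obtain ⟨s, hs, hxs⟩ := hx
  have hle : ∀ q, |φ q| ≤ 1 := by
    intro q
    by_cases hq : q = r
    · rw [hq]; nlinarith
    · exact (hφ q hq).2
  have hge : c * θ / 2 ≤ |φ s| := by
    by_cases hq : s = r
    · rw [hq]; exact h2
    · have := (hφ s hq).1
      nlinarith
  rw [norm_eq_of_nearAxis hα1 hxs]
  have h3 : φ ⬝ᵥ x = φ s * x s + φ ⬝ᵥ (fun q => if q = s then 0 else x q) := by
    have : x = (fun q => if q = s then x q else 0) + fun q => if q = s then 0 else x q := by
      ext q; by_cases hq : q = s <;> simp [hq]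
    nth_rw 1 [this]
    rw [dotProduct_add]
    simp [dotProduct]
  have h4 : |φ ⬝ᵥ (fun q => if q = s then 0 else x q)| ≤ n * (α * |x s|) := by
    refine abs_dotProduct_le fun q => ?_
    by_cases hq : q = s
    · simp [hq]; positivity
    · simp only [hq, if_false, abs_mul]
      calc _ ≤ 1 * |x q| := by gcongr; exact hle q
        _ ≤ _ := by rw [one_mul]; exact hxs q hq
  rw [h3]
  have h5 := abs_sub_abs_le_abs_add (φ s * x s) (φ ⬝ᵥ (fun q => if q = s then 0 else x q))
  rw [abs_mul] at h5
  have h6 := abs_nonneg (x s)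
  have h7 := mul_le_mul_of_nonneg_right hge h6
  have h8 := mul_le_mul_of_nonneg_right hα h6
  have h9 : 0 ≤ c * θ * |x s| := by positivity
  linarith

theorem push_cone {θ α κ : ℝ} {r r' : Fin n} (hrr : r ≠ r') (hα0 : 0 < α) (hα1 : α ≤ 1)
    (hκ : 0 < κ) (hθ : 0 ≤ θ) (hθ1 : θ ≤ 1) {v x : Fin n → ℝ} (hv : v r = 1)
    (hvp : ∀ q, |v q - tilt r r' θ q| ≤ α / 2) (hx : x ≠ 0) {s d μ : ℝ}
    (hd : κ * ‖x‖ ≤ |d|) (hμ : 6 / (α * κ) ≤ |μ|) (hs : s = μ * d) :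
    x + s • v ∈ cone r r' θ α := by
  have hxn : 0 < ‖x‖ := norm_pos_iff.2 hx
  have hs6 : 6 * ‖x‖ ≤ α * |s| := by
    rw [hs, abs_mul]
    have : 6 ≤ |μ| * (α * κ) := (div_le_iff₀ (by positivity)).1 hμ
    calc 6 * ‖x‖ ≤ |μ| * (α * κ) * ‖x‖ := by gcongr
      _ = α * (|μ| * (κ * ‖x‖)) := by ring
      _ ≤ _ := by gcongr
  have hs6' : 6 * ‖x‖ ≤ |s| := by nlinarith [abs_nonneg s]
  have hz : (x + s • v) r = x r + s := by simp [hv]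
  have hxr : |x r| ≤ ‖x‖ := norm_le_pi_norm x r
  have hzr : |s| - ‖x‖ ≤ |x r + s| := by
    have := abs_sub_abs_le_abs_add s (x r)
    rw [add_comm] at this
    linarith
  refine ⟨?_, fun q => ?_⟩
  · rw [hz, ← abs_pos]; linarith
  · rw [hz]
    have h1 : (x + s • v) q - (x r + s) * tilt r r' θ q
      = x q - x r * tilt r r' θ q + s * (v q - tilt r r' θ q) := by simp; ring
    have h2 : |tilt r r' θ q| ≤ 1 := by
      by_cases h : q = r
      · simp [tilt, h, hrr]
      · simp only [tilt, h, if_false, zero_add]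
        split_ifs
        · rwa [abs_of_nonneg hθ]
        · simp
    rw [h1]
    have h3 : |x r * tilt r r' θ q| ≤ ‖x‖ := by
      rw [abs_mul]; nlinarith [abs_nonneg (x r), abs_nonneg (tilt r r' θ q)]
    have h4 : |s * (v q - tilt r r' θ q)| ≤ |s| * (α / 2) := by
      rw [abs_mul]; gcongr; exact hvp q
    have h5 : |x q| ≤ ‖x‖ := norm_le_pi_norm x q
    calc _ ≤ |x q - x r * tilt r r' θ q| + |s * (v q - tilt r r' θ q)| := abs_add_le _ _
      _ ≤ (|x q| + |x r * tilt r r' θ q|) + |s * (v q - tilt r r' θ q)| := by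
        gcongr; exact abs_sub _ _
      _ ≤ α * (|s| - ‖x‖) := by nlinarith
      _ ≤ _ := by gcongr

theorem Inv.step {c η κ θ : ℝ} {A : Subgroup (SLZ n)} {Y : Set (Fin n → ℝ)} (h : Inv c A Y η κ)
    (hc : 0 < c) (hc1 : c ≤ 1) {r r' : Fin n} (hrr : r ≠ r') (hθ : 0 < θ) (hθη : θ ≤ η / 2)
    (hθc : θ ≤ c / 8) :
    ∃ α > 0, ∃ M₀ : ℝ, ∃ Y' η' κ', ∀ (T : SLZ n) (v φ : Fin n → ℝ) (l : ℝ),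
      (∀ (m : ℤ) x, matR (T ^ m) *ᵥ x = x + (m * l * (φ ⬝ᵥ x)) • v) → v r = 1 →
      (∀ q, |v q - tilt r r' θ q| ≤ α) → φ ⬝ᵥ v = 0 → (∀ q ≠ r, c ≤ |φ q| ∧ |φ q| ≤ 1) →
      M₀ ≤ |l| → Inv c (A ⊔ Subgroup.zpowers T) Y' η' κ' := by
  have hn : 0 < (n : ℝ) := by exact_mod_cast r.pos
  have hn1 : 1 ≤ (n : ℝ) := by exact_mod_cast r.pos
  have h0 := h.eta_pos
  have h0' := h.eta_le
  have hk := h.kappa_pos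
  set α : ℝ := c * θ / (8 * n) with hαd
  have hα0 : 0 < α := by positivity
  have hα : n * α = c * θ / 8 := by rw [hαd]; field_simp
  have hα' : α ≤ c * θ / 8 := by nlinarith
  have hcθ : c * θ ≤ θ := by nlinarith
  have hαη : α ≤ η := by nlinarith
  have hα1 : α ≤ 1 := by linarith
  set κ' : ℝ := min κ (c * θ / 4) with hκ'
  have hκ0 : 0 < κ' := lt_min hk (by positivity)
  refine ⟨α / 2, by positivity, 6 / (α * κ'), Y ∪ cone r r' θ α, α, κ', ?_⟩
  intro T v φ l hT hv hvp hφv hφ hl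
  obtain ⟨hr1, hr2⟩ := transvection_form hrr hθ hc1 hθc hα.le hv hvp hα0.le hφv hφ
  have hcn : ∀ y ∈ cone r r' θ α, y ∈ nearAxis n η := by
    intro y hy
    refine ⟨r, hy.1, fun q hq => (cone_near hθ.le hy q hq).trans ?_⟩
    gcongr
    linarith
  have hφA : Allowed c η φ := ⟨r, by linarith, hφ⟩
  refine ⟨hα0, by linarith, hκ0, ?_, ?_, ?_⟩
  · intro g hg x hx
    refine ping_pong (f := fun g x => matR g *ᵥ x) (by simp [matR_one])
      (by intro g h y; simp [matR_mul]) A (Subgroup.zpowers T) Y (cone r r' θ α) x ?_ ?_ g hg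
    · intro y hy a ha
      refine h.move a ha y ?_
      rcases hy with rfl | hy
      · exact nearAxis_mono hαη hx
      · exact hcn y hy
    · rintro y hy _ ⟨m, rfl⟩
      by_cases hm : m = 0
      · left; simp [hm, matR_one]
      right
      have hm1 : (1 : ℝ) ≤ |(m : ℝ)| := by exact_mod_cast Int.one_le_abs hm
      have hml : 6 / (α * κ') ≤ |(m : ℝ) * l| := by
        rw [abs_mul]; nlinarith [abs_nonneg l]
      simp only [hT]
      have hy2 : y ≠ 0 ∧ κ' * ‖y‖ ≤ |φ ⬝ᵥ y| := by
        rcases hy with rfl | hy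
        · refine ⟨?_, ?_⟩
          · obtain ⟨s, hs, -⟩ := hx
            rintro rfl; exact hs rfl
          · refine le_trans ?_ (form_near hθ hc hc1 hθc hα.le hα0.le hφ hr1 hr2 hα1 hx)
            gcongr
            exact min_le_right _ _
        · refine ⟨?_, ?_⟩
          · obtain ⟨s, hs, -⟩ := h.sub hy
            rintro rfl; exact hs rfl
          · refine le_trans ?_ (h.far φ hφA y hy)
            gcongr
            exact min_le_left _ _
      exact push_cone hrr hα0 hα1 hκ0 hθ.le (by linarith) hv hvp hy2.1 hy2.2 hml rfl
  · intro ψ hψ y hy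
    rcases hy with hy | hy
    · refine le_trans ?_ (h.far ψ ?_ y hy)
      · gcongr; exact min_le_left _ _
      · obtain ⟨s, hs, hs'⟩ := hψ
        exact ⟨s, by linarith, hs'⟩
    · have := cone_far hrr hθ hc1 hθc hα' hα.le hy hψ
      refine le_trans ?_ this
      rw [norm_eq_of_nearAxis (η := θ + α) (by linarith) (cone_near hθ.le hy)]
      gcongr
      refine (min_le_right _ _).trans ?_
      nlinarith
  · rintro y (hy | hy)
    · exact h.sub hy
    · exact nearAxis_mono h0' (hcn y hy)

/-- The transvection `x ↦ x + φ(x) v`. -/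
def tv (v φ : Fin n → ℤ) (h : φ ⬝ᵥ v = 0) : SLZ n :=
  ⟨1 + vecMulVec v φ, by
    rw [vecMulVec_eq Unit, det_one_add_replicateCol_mul_replicateRow, h, add_zero]⟩

theorem tv_coe (v φ : Fin n → ℤ) (h : φ ⬝ᵥ v = 0) :
    (tv v φ h : Matrix (Fin n) (Fin n) ℤ) = 1 + vecMulVec v φ := rfl

theorem one_add_vecMulVec_mul {R : Type*} [CommRing R] (v φ ψ : Fin n → R) (h : φ ⬝ᵥ v = 0) :
    (1 + vecMulVec v φ) * (1 + vecMulVec v ψ) = 1 + vecMulVec v (φ + ψ) := by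
  rw [mul_add, mul_one, add_mul, one_mul, vecMulVec_mul_vecMulVec, h, zero_smul, vecMulVec_zero,
    add_zero, vecMulVec_add, add_assoc]

theorem tv_mul (v φ ψ : Fin n → ℤ) (h : φ ⬝ᵥ v = 0) (h' : ψ ⬝ᵥ v = 0) :
    tv v φ h * tv v ψ h' = tv v (φ + ψ) (by rw [add_dotProduct, h, h', add_zero]) := by
  apply Subtype.ext
  exact one_add_vecMulVec_mul v φ ψ h

theorem tv_zpow (v φ : Fin n → ℤ) (h : φ ⬝ᵥ v = 0) (m : ℤ) :
    tv v φ h ^ m = tv v (m • φ) (by rw [smul_dotProduct, h, smul_zero]) := by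
  have hnat : ∀ k : ℕ, tv v φ h ^ k = tv v ((k : ℤ) • φ)
      (by rw [smul_dotProduct, h, smul_zero]) := by
    intro k
    induction k with
    | zero => apply Subtype.ext; simp [tv_coe]
    | succ k ih =>
      rw [pow_succ, ih, tv_mul]
      congr 1
      push_cast
      rw [add_smul, one_smul]
  obtain ⟨k, rfl | rfl⟩ := m.eq_nat_or_neg
  · rw [zpow_natCast, hnat]
  · rw [_root_.zpow_neg, zpow_natCast, hnat, inv_eq_iff_mul_eq_one, tv_mul]
    apply Subtype.ext
    simp [tv_coe]

theorem matR_apply (g : SLZ n) (i j : Fin n) : matR g i j = (g.1 i j : ℝ) := rfl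

theorem matQ_apply (g : SLZ n) (i j : Fin n) : matQ g i j = (g.1 i j : ℚ) := rfl

theorem matR_tv (v φ : Fin n → ℤ) (h : φ ⬝ᵥ v = 0) :
    matR (tv v φ h) = 1 + vecMulVec (fun i => (v i : ℝ)) (fun i => (φ i : ℝ)) := by
  ext i j
  rw [matR_apply, tv_coe]
  by_cases hij : i = j <;> simp [vecMulVec_apply, one_apply, hij]

theorem matQ_tv (v φ : Fin n → ℤ) (h : φ ⬝ᵥ v = 0) :
    matQ (tv v φ h) = 1 + vecMulVec (fun i => (v i : ℚ)) (fun i => (φ i : ℚ)) := by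
  ext i j
  rw [matQ_apply, tv_coe]
  by_cases hij : i = j <;> simp [vecMulVec_apply, one_apply, hij]

theorem matR_tv_zpow (v φ : Fin n → ℤ) (h : φ ⬝ᵥ v = 0) (m : ℤ) (x : Fin n → ℝ) :
    matR (tv v φ h ^ m) *ᵥ x
      = x + (m * ((fun i => (φ i : ℝ)) ⬝ᵥ x)) • (fun i => (v i : ℝ)) := by
  rw [tv_zpow, matR_tv, add_mulVec, one_mulVec, vecMulVec_mulVec]
  congr 1
  ext i
  simp [dotProduct, Finset.mul_sum, mul_assoc, mul_comm]

/-- A subgroup satisfying the ping-pong invariant for some parameters. -/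
def State (c : ℝ) (A : Subgroup (SLZ n)) : Prop := ∃ Y η κ, Inv c A Y η κ

theorem state_bot (c : ℝ) : State c (⊥ : Subgroup (SLZ n)) := by
  refine ⟨∅, 1 / 2, 1, by norm_num, le_rfl, one_pos, ?_, by simp, by simp⟩
  intro a ha x _
  rw [Subgroup.mem_bot] at ha
  simp [ha, matR_one]

theorem State.step {c : ℝ} {A : Subgroup (SLZ n)} (h : State c A) (hc : 0 < c) (hc1 : c ≤ 1)
    {r r' : Fin n} (hrr : r ≠ r') :
    ∃ N₀ : ℕ, 2 ≤ N₀ ∧ ∀ N : ℕ, N₀ ≤ N → ∃ α > 0, ∃ M₀ : ℝ, ∀ (v φ : Fin n → ℤ) (h : φ ⬝ᵥ v = 0)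
      (f : ℝ), 0 < f → v r ≠ 0 →
      (∀ q, |(v q : ℝ) - v r * tilt r r' (1 / N) q| ≤ α * |(v r : ℝ)|) →
      (∀ q ≠ r, c * f ≤ |(φ q : ℝ)| ∧ |(φ q : ℝ)| ≤ f) → M₀ ≤ f * |(v r : ℝ)| →
      State c (A ⊔ Subgroup.zpowers (tv v φ h)) := by
  obtain ⟨Y, η, κ, hI⟩ := h
  have hη := hI.eta_pos
  obtain ⟨N₀, hN₀⟩ := exists_nat_gt (max (2 / η) (8 / c))
  refine ⟨max 2 N₀, le_max_left _ _, fun N hN => ?_⟩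
  have hNN : (N₀ : ℝ) ≤ N := by exact_mod_cast (le_max_right _ _).trans hN
  have h1 : 2 / η < N := (le_max_left _ _).trans_lt (hN₀.trans_le hNN)
  have h2 : 8 / c < N := (le_max_right _ _).trans_lt (hN₀.trans_le hNN)
  have hNp : (0 : ℝ) < N := lt_trans (by positivity) h1
  have h1' : (1 : ℝ) / N ≤ η / 2 := by
    rw [div_lt_iff₀ hη] at h1
    rw [div_le_iff₀ hNp]; nlinarith
  have h2' : (1 : ℝ) / N ≤ c / 8 := by
    rw [div_lt_iff₀ hc] at h2
    rw [div_le_iff₀ hNp]; nlinarith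
  obtain ⟨α, hα, M₀, Y', η', κ', hmain⟩ := hI.step hc hc1 hrr (θ := 1 / N) (by positivity) h1' h2'
  refine ⟨α, hα, M₀, ?_⟩
  intro v φ hφv f hf hvr hv hφ hM
  have hvr' : (v r : ℝ) ≠ 0 := by exact_mod_cast hvr
  have hva : 0 < |(v r : ℝ)| := abs_pos.2 hvr'
  refine ⟨Y', η', κ', hmain _ (fun q => (v q : ℝ) / v r) (fun q => (φ q : ℝ) / f) (f * v r) ?_ ?_
    ?_ ?_ ?_ ?_⟩
  · intro m x
    rw [matR_tv_zpow]
    congr 1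
    have : (fun q => (φ q : ℝ) / f) ⬝ᵥ x = ((fun q => (φ q : ℝ)) ⬝ᵥ x) / f := by
      simp only [dotProduct, Finset.sum_div]
      exact Finset.sum_congr rfl fun q _ => by ring
    rw [this]
    ext i
    simp only [Pi.smul_apply, smul_eq_mul]
    field_simp
  · simp [hvr']
  · intro q
    have := hv q
    rw [← div_le_iff₀ hva, ← abs_div, sub_div, mul_div_cancel_left₀ _ hvr'] at this
    exact this
  · have h0 : ((φ ⬝ᵥ v : ℤ) : ℝ) = 0 := by rw [hφv]; simp
    simp only [dotProduct, Int.cast_sum, Int.cast_mul] at h0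
    simp only [dotProduct]
    calc _ = (∑ i, (φ i : ℝ) * v i) / (f * v r) := by
          rw [Finset.sum_div]
          exact Finset.sum_congr rfl fun q _ => by field_simp
      _ = 0 := by rw [h0, zero_div]
  · intro q hq
    rw [abs_div, abs_of_pos hf, le_div_iff₀ hf, div_le_one hf]
    exact hφ q hq
  · rw [abs_mul, abs_of_pos hf]; exact hM

/-- The integer direction `N e_r + e_{r'}`. -/
def dir (N : ℤ) (r r' : Fin n) : Fin n → ℤ := fun q => (if q = r then N else 0) +
  if q = r' then 1 else 0

/-- The integer form `N ρ - ρ_{r'} e_r^*` (`ρ` without its `r`-th coordinate), which vanishes on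
`N e_r + e_{r'}`. -/
def form (N : ℤ) (r r' : Fin n) (ρ : Fin n → ℤ) : Fin n → ℤ := fun q =>
  if q = r then -ρ r' else N * ρ q

theorem dotProduct_dir {R : Type*} [CommRing R] (φ : Fin n → R) (N : ℤ) (r r' : Fin n) :
    φ ⬝ᵥ (fun q => ((dir N r r' q : ℤ) : R)) = N * φ r + φ r' := by
  simp [dir, dotProduct, mul_add, Finset.sum_add_distrib, mul_comm]

theorem form_dotProduct {R : Type*} [CommRing R] (N : ℤ) (r r' : Fin n) (ρ : Fin n → ℤ)
    (z : Fin n → R) : (fun q => ((form N r r' ρ q : ℤ) : R)) ⬝ᵥ z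
      = N * (∑ q ∈ Finset.univ.erase r, ρ q * z q) - ρ r' * z r := by
  simp only [dotProduct, form]
  rw [← Finset.add_sum_erase _ _ (Finset.mem_univ r), Finset.mul_sum]
  simp only [if_true]
  rw [Finset.sum_congr rfl (g := fun q => (N : R) * (ρ q * z q))]
  · push_cast; ring
  · intro q hq
    rw [if_neg (Finset.ne_of_mem_erase hq)]
    push_cast; ring

theorem form_dir (N : ℤ) {r r' : Fin n} (hrr : r ≠ r') (ρ : Fin n → ℤ) :
    form N r r' ρ ⬝ᵥ dir N r r' = 0 := by
  have := dotProduct_dir (form N r r' ρ) N r r'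
  simp only [Int.cast_id] at this
  rw [this]
  simp [form, hrr.symm]

theorem State.step_exact {c : ℝ} {A : Subgroup (SLZ n)} (h : State c A) (hc : 0 < c) (hc1 : c ≤ 1)
    {r r' : Fin n} (hrr : r ≠ r') :
    ∃ N₀ : ℕ, 2 ≤ N₀ ∧ ∀ N : ℕ, N₀ ≤ N → ∃ M : ℤ, 0 < M ∧ ∀ (ρ : Fin n → ℤ) (b : ℝ), 1 ≤ b →
      (∀ q ≠ r, c * b ≤ |(ρ q : ℝ)| ∧ |(ρ q : ℝ)| ≤ b) →
      State c (A ⊔ Subgroup.zpowers (tv (dir N r r') (M • form N r r' ρ)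
        (by rw [smul_dotProduct, form_dir N hrr, smul_zero]))) := by
  obtain ⟨N₀, h2, hN₀⟩ := h.step hc hc1 hrr
  refine ⟨N₀, h2, fun N hN => ?_⟩
  obtain ⟨α, hα, M₀, H⟩ := hN₀ N hN
  obtain ⟨k, hk⟩ := exists_nat_gt (max M₀ 1)
  have hk1 : (1 : ℝ) < k := (le_max_right _ _).trans_lt hk
  have hN1 : (2 : ℝ) ≤ N := by exact_mod_cast h2.trans hN
  refine ⟨k, by exact_mod_cast lt_trans one_pos hk1, fun ρ b hb hρ => ?_⟩
  have hdr : dir N r r' r = N := by simp [dir, hrr]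
  refine H _ _ _ (k * N * b) (by positivity) (by rw [hdr]; exact_mod_cast (by linarith)) ?_ ?_ ?_
  · intro q
    rw [hdr]
    have : ((dir N r r' q : ℤ) : ℝ) = (N : ℤ) * tilt r r' (1 / N) q := by
      simp only [dir, tilt]
      have : (N : ℝ) ≠ 0 := by linarith
      push_cast
      split_ifs <;> field_simp <;> ring
    rw [this]
    simp; positivity
  · intro q hq
    have : (((k : ℤ) • form N r r' ρ) q : ℝ) = k * N * ρ q := by
      simp [form, hq]; ring
    rw [this, abs_mul, abs_of_pos (a := (k : ℝ) * N) (by positivity)]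
    have h3 := hρ q hq
    constructor
    · calc c * (k * N * b) = k * N * (c * b) := by ring
        _ ≤ _ := by gcongr; exact h3.1
    · gcongr; exact h3.2
  · rw [hdr]
    have : |(((N : ℤ) : ℝ))| = N := by simp
    rw [this]
    have : (k : ℝ) * 1 * 1 * 1 ≤ k * N * b * N := by gcongr <;> linarith
    linarith [le_max_left M₀ 1]

theorem matQ_one : matQ (1 : SLZ n) = 1 := by simp [matQ]

theorem matQ_mul (g h : SLZ n) : matQ (g * h) = matQ g * matQ h := by simp [matQ]

/-- `H` contains a nontrivial rational multiple of the transvection attached to the flag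
`(u, ker ψ)`. -/
def Flag (H : Subgroup (SLZ n)) (u ψ : Fin n → ℚ) : Prop :=
  ψ ⬝ᵥ u = 0 ∧ ∃ m : ℚ, m ≠ 0 ∧ ∃ g ∈ H, matQ g = 1 + m • vecMulVec u ψ

theorem Flag.mono {H H' : Subgroup (SLZ n)} (hH : H ≤ H') {u ψ : Fin n → ℚ} (h : Flag H u ψ) :
    Flag H' u ψ := by
  obtain ⟨h0, m, hm, g, hg, h⟩ := h
  exact ⟨h0, m, hm, g, hH hg, h⟩

theorem matQ_inv_eq {g : SLZ n} {u ψ : Fin n → ℚ} (h0 : ψ ⬝ᵥ u = 0) {m : ℚ}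
    (h : matQ g = 1 + m • vecMulVec u ψ) : matQ g⁻¹ = 1 + (-m) • vecMulVec u ψ := by
  have h1 : matQ g⁻¹ * matQ g = 1 := by rw [← matQ_mul, inv_mul_cancel, matQ_one]
  have h2 : matQ g * (1 + (-m) • vecMulVec u ψ) = 1 := by
    rw [h]
    simp [mul_add, add_mul, vecMulVec_mul_vecMulVec, h0]
  calc matQ g⁻¹ = matQ g⁻¹ * (matQ g * (1 + (-m) • vecMulVec u ψ)) := by rw [h2, mul_one]
    _ = _ := by rw [← mul_assoc, h1, one_mul]

theorem matQ_zpow_eq {g : SLZ n} {u ψ : Fin n → ℚ} (h0 : ψ ⬝ᵥ u = 0) {m : ℚ}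
    (h : matQ g = 1 + m • vecMulVec u ψ) (k : ℤ) :
    matQ (g ^ k) = 1 + (k * m) • vecMulVec u ψ := by
  have hnat : ∀ k : ℕ, matQ (g ^ k) = 1 + (k * m) • vecMulVec u ψ := by
    intro k
    induction k with
    | zero => simp [matQ_one]
    | succ k ih =>
      rw [pow_succ, matQ_mul, ih, h]
      simp only [mul_add, add_mul, mul_one, one_mul, smul_mul_smul_comm, vecMulVec_mul_vecMulVec,
        h0, zero_smul, vecMulVec_zero, smul_zero]
      push_cast
      module
  obtain ⟨k, rfl | rfl⟩ := k.eq_nat_or_neg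
  · rw [zpow_natCast, hnat]; simp
  · rw [_root_.zpow_neg, zpow_natCast, matQ_inv_eq h0 (hnat k)]; simp

theorem Flag.exists_pos {H : Subgroup (SLZ n)} {u ψ : Fin n → ℚ} (h : Flag H u ψ) :
    ∃ k : ℤ, 0 < k ∧ ∀ j : ℤ, ∃ g ∈ H, matQ g = 1 + ((j * k : ℤ) : ℚ) • vecMulVec u ψ := by
  obtain ⟨h0, m, hm, g, hg, h⟩ := h
  refine ⟨|m.num|, abs_pos.2 (by simpa using hm), fun j => ?_⟩
  refine ⟨g ^ (j * m.num.sign * m.den), zpow_mem hg _, ?_⟩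
  rw [matQ_zpow_eq h0 h]
  congr 2
  rw [← Int.sign_mul_self_eq_abs]
  push_cast
  have : (m.den : ℚ) * m = m.num := by rw [mul_comm]; exact Rat.mul_den_eq_num m
  rw [mul_assoc, this, mul_assoc]

theorem Flag.of_zero {H : Subgroup (SLZ n)} {u ψ : Fin n → ℚ} (h : u = 0 ∨ ψ = 0) :
    Flag H u ψ := by
  refine ⟨?_, 1, one_ne_zero, 1, H.one_mem, ?_⟩ <;> rcases h with rfl | rfl <;> simp [matQ_one]

theorem Flag.smul_right {H : Subgroup (SLZ n)} {u ψ : Fin n → ℚ} (h : Flag H u ψ) (a : ℚ) :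
    Flag H u (a • ψ) := by
  by_cases ha : a = 0
  · exact Flag.of_zero (Or.inr (by simp [ha]))
  obtain ⟨h0, m, hm, g, hg, h⟩ := h
  refine ⟨by simp [h0], m / a, by positivity, g, hg, ?_⟩
  rw [h, vecMulVec_smul, smul_smul]
  congr 2
  field_simp

theorem Flag.smul_left {H : Subgroup (SLZ n)} {u ψ : Fin n → ℚ} (h : Flag H u ψ) (a : ℚ) :
    Flag H (a • u) ψ := by
  by_cases ha : a = 0
  · exact Flag.of_zero (Or.inl (by simp [ha]))
  obtain ⟨h0, m, hm, g, hg, h⟩ := h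
  refine ⟨by simp [h0], m / a, by positivity, g, hg, ?_⟩
  rw [h, smul_vecMulVec, smul_smul]
  congr 2
  field_simp

theorem Flag.add_right {H : Subgroup (SLZ n)} {u ψ χ : Fin n → ℚ} (h : Flag H u ψ)
    (h' : Flag H u χ) : Flag H u (ψ + χ) := by
  have h0 := h.1
  have h0' := h'.1
  obtain ⟨k, hk, h⟩ := h.exists_pos
  obtain ⟨k', hk', h'⟩ := h'.exists_pos
  obtain ⟨g, hg, hgm⟩ := h k'
  obtain ⟨g', hg', hgm'⟩ := h' k
  refine ⟨by simp [add_dotProduct, h0, h0'], ((k' * k : ℤ) : ℚ), by positivity, g * g',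
    mul_mem hg hg', ?_⟩
  rw [matQ_mul, hgm, hgm', mul_comm k k']
  simp only [mul_add, add_mul, mul_one, one_mul, smul_mul_smul_comm, vecMulVec_mul_vecMulVec,
    h0, zero_smul, vecMulVec_zero, smul_zero, vecMulVec_add]
  module

theorem Flag.add_left {H : Subgroup (SLZ n)} {u w ψ : Fin n → ℚ} (h : Flag H u ψ)
    (h' : Flag H w ψ) : Flag H (u + w) ψ := by
  have h0 := h.1
  have h0' := h'.1
  obtain ⟨k, hk, h⟩ := h.exists_pos
  obtain ⟨k', hk', h'⟩ := h'.exists_pos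
  obtain ⟨g, hg, hgm⟩ := h k'
  obtain ⟨g', hg', hgm'⟩ := h' k
  refine ⟨by simp [dotProduct_add, h0, h0'], ((k' * k : ℤ) : ℚ), by positivity, g * g',
    mul_mem hg hg', ?_⟩
  rw [matQ_mul, hgm, hgm', mul_comm k k']
  simp only [mul_add, add_mul, mul_one, one_mul, smul_mul_smul_comm, vecMulVec_mul_vecMulVec,
    h0', zero_smul, vecMulVec_zero, smul_zero, add_vecMulVec]
  module

theorem Flag.commutator {H : Subgroup (SLZ n)} {u w ψ χ : Fin n → ℚ} (h : Flag H u ψ)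
    (h' : Flag H w χ) (h1 : χ ⬝ᵥ u = 0) (h2 : ψ ⬝ᵥ w ≠ 0) : Flag H u χ := by
  obtain ⟨h0, m, hm, g, hg, h⟩ := h
  obtain ⟨h0', m', hm', g', hg', h'⟩ := h'
  refine ⟨h1, m * m' * (ψ ⬝ᵥ w), by positivity, g * g' * g⁻¹ * g'⁻¹,
    mul_mem (mul_mem (mul_mem hg hg') (inv_mem hg)) (inv_mem hg'), ?_⟩
  have key : matQ (g * g') = (1 + (m * m' * (ψ ⬝ᵥ w)) • vecMulVec u χ) * matQ (g' * g) := by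
    rw [matQ_mul, matQ_mul, h, h']
    simp only [mul_add, add_mul, mul_one, one_mul, vecMulVec_mul_vecMulVec, h0', h1,
      zero_smul, vecMulVec_zero, smul_zero, vecMulVec_smul, smul_mul_assoc,
      mul_smul_comm, add_zero]
    module
  have : g * g' * g⁻¹ * g'⁻¹ = (g * g') * (g' * g)⁻¹ := by group
  rw [this, matQ_mul, key, mul_assoc, ← matQ_mul, mul_inv_cancel, matQ_one, mul_one]

theorem Flag.conj {H : Subgroup (SLZ n)} {u ψ : Fin n → ℚ} (h : Flag H u ψ) {g : SLZ n}
    (hg : g ∈ H) : Flag H (matQ g *ᵥ u) (ψ ᵥ* matQ g⁻¹) := by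
  obtain ⟨h0, m, hm, a, ha, h⟩ := h
  refine ⟨?_, m, hm, g * a * g⁻¹, mul_mem (mul_mem hg ha) (inv_mem hg), ?_⟩
  · rw [← dotProduct_mulVec, mulVec_mulVec, ← matQ_mul, inv_mul_cancel, matQ_one, one_mulVec, h0]
  · rw [matQ_mul, matQ_mul, h, mul_add, add_mul, mul_one, ← matQ_mul, mul_inv_cancel, matQ_one,
      mul_smul_comm, smul_mul_assoc, mul_vecMulVec, vecMulVec_mul]

theorem flag_of_tv_mem {H : Subgroup (SLZ n)} {v φ : Fin n → ℤ} {M : ℤ} (hM : M ≠ 0)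
    {h : (M • φ) ⬝ᵥ v = 0} (hH : tv v (M • φ) h ∈ H) :
    Flag H (fun i => (v i : ℚ)) (fun i => (φ i : ℚ)) := by
  have hM' : (M : ℚ) ≠ 0 := by exact_mod_cast hM
  refine ⟨?_, M, hM', _, hH, ?_⟩
  · rw [smul_dotProduct, smul_eq_mul, mul_eq_zero, or_iff_right hM] at h
    have : ((φ ⬝ᵥ v : ℤ) : ℚ) = 0 := by rw [h]; simp
    simpa [dotProduct] using this
  · rw [matQ_tv, ← vecMulVec_smul]
    congr 2
    ext i; simp

/-- The forms `ψ` such that the flag `(u, ker ψ)` belongs to `H`. -/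
def formSpace (H : Subgroup (SLZ n)) (u : Fin n → ℚ) : Submodule ℚ (Fin n → ℚ) where
  carrier := {ψ | Flag H u ψ}
  add_mem' := Flag.add_right
  zero_mem' := Flag.of_zero (Or.inr rfl)
  smul_mem' a _ h := h.smul_right a

/-- All the flags through `u` belong to `H`. -/
def Full (H : Subgroup (SLZ n)) (u : Fin n → ℚ) : Prop := ∀ ψ, ψ ⬝ᵥ u = 0 → Flag H u ψ

theorem Full.smul {H : Subgroup (SLZ n)} {u : Fin n → ℚ} (h : Full H u) (a : ℚ) :
    Full H (a • u) := by
  intro ψ hψ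
  by_cases ha : a = 0
  · exact Flag.of_zero (Or.inl (by simp [ha]))
  refine (h ψ ?_).smul_left a
  simpa [ha] using hψ

theorem Full.mono {H H' : Subgroup (SLZ n)} (hH : H ≤ H') {u : Fin n → ℚ} (h : Full H u) :
    Full H' u := fun ψ hψ => (h ψ hψ).mono hH

theorem Full.conj {H : Subgroup (SLZ n)} {u : Fin n → ℚ} (h : Full H u) {g : SLZ n}
    (hg : g ∈ H) : Full H (matQ g *ᵥ u) := by
  intro ψ hψ
  have := (h (ψ ᵥ* matQ g) (by rwa [← dotProduct_mulVec])).conj hg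
  rwa [vecMul_vecMul, ← matQ_mul, mul_inv_cancel, matQ_one, vecMul_one] at this

theorem exists_dotProduct_ne {S : Submodule ℚ (Fin n → ℚ)} {z : Fin n → ℚ} (hz : z ∉ S) :
    ∃ χ : Fin n → ℚ, (∀ u ∈ S, χ ⬝ᵥ u = 0) ∧ χ ⬝ᵥ z ≠ 0 := by
  obtain ⟨f, hf, hS⟩ := Submodule.exists_le_ker_of_notMem hz
  have h : ∀ u, f u = (fun i => f (Pi.single i 1)) ⬝ᵥ u := by
    intro u
    rw [LinearMap.pi_apply_eq_sum_univ f u]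
    simp only [dotProduct, smul_eq_mul]
    exact Finset.sum_congr rfl fun i _ => by
      rw [mul_comm]; congr 2; ext j; simp [Pi.single_apply, eq_comm]
  refine ⟨fun i => f (Pi.single i 1), fun u hu => ?_, ?_⟩
  · rw [← h]; exact hS hu
  · rw [← h]; exact hf

theorem full_of_span (hn : 3 ≤ n) {H : Subgroup (SLZ n)}
    (hspan : Submodule.span ℚ {u | Full H u} = ⊤) (u : Fin n → ℚ) : Full H u := by
  have hadd : ∀ u w, Full H u → Full H w → Full H (u + w) := by
    intro u w hu hw ψ hψ
    have : ∃ z, Full H z ∧ z ∉ Submodule.span ℚ {u, w} := by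
      by_contra! hcon
      have h1 : (⊤ : Submodule ℚ (Fin n → ℚ)) ≤ Submodule.span ℚ {u, w} := by
        rw [← hspan, Submodule.span_le]; exact hcon
      have h2 := Submodule.finrank_mono h1
      have h3 := finrank_span_le_card (R := ℚ) ({u, w} : Set (Fin n → ℚ))
      have h4 : ({u, w} : Set (Fin n → ℚ)).toFinset.card ≤ 2 := by
        simp only [Set.toFinset_insert, Set.toFinset_singleton]
        exact Finset.card_le_two
      rw [finrank_top, Module.finrank_fin_fun] at h2
      omega
    obtain ⟨z, hz, hzs⟩ := this
    obtain ⟨χ, hχ, hχz⟩ := exists_dotProduct_ne hzs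
    have hχu := hχ u (Submodule.subset_span (by simp))
    have hχw := hχ w (Submodule.subset_span (by simp))
    have hp : Flag H (u + w) χ := (hu χ hχu).add_left (hw χ hχw)
    set a : ℚ := (ψ ⬝ᵥ z) / (χ ⬝ᵥ z) with ha
    have h1 : Flag H z (ψ - a • χ) := by
      refine hz _ ?_
      rw [sub_dotProduct, smul_dotProduct, ha, smul_eq_mul, div_mul_cancel₀ _ hχz, sub_self]
    have h2 : Flag H (u + w) (ψ - a • χ) := by
      refine hp.commutator h1 ?_ hχz
      rw [sub_dotProduct, smul_dotProduct, hψ, hp.1, smul_zero, sub_zero]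
    have := h2.add_right (hp.smul_right a)
    rwa [sub_add_cancel] at this
  have hmem : u ∈ Submodule.span ℚ {u | Full H u} := by rw [hspan]; trivial
  induction hmem using Submodule.span_induction with
  | mem x h => exact h
  | zero => exact fun _ _ => Flag.of_zero (Or.inl rfl)
  | add x y _ _ hx hy => exact hadd x y hx hy
  | smul a x _ hx => exact hx.smul a

theorem eventually_mul_sub_ne {x y : ℚ} (h : x ≠ 0 ∨ y ≠ 0) :
    ∃ N₁ : ℕ, ∀ N : ℕ, N₁ ≤ N → (N : ℚ) * x - y ≠ 0 := by
  by_cases hx : x = 0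
  · exact ⟨0, fun N _ => by simpa [hx] using h⟩
  obtain ⟨N₁, hN₁⟩ := exists_nat_gt (y / x)
  refine ⟨N₁, fun N hN h0 => ?_⟩
  have h1 : (N₁ : ℚ) ≤ N := by exact_mod_cast hN
  have : y / x = N := by rw [div_eq_iff hx]; linarith
  linarith

/-- The values at `z` of the coordinate forms, reduced along `N e_r + e_{r'}`. -/
def red {R : Type*} [CommRing R] (N : ℕ) (r r' : Fin n) (z : Fin n → R) (q : Fin n) : R :=
  N * z q - if q = r' then z r else 0

theorem form_dotProduct_red {R : Type*} [CommRing R] (N : ℕ) {r r' : Fin n} (hrr : r ≠ r')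
    (ρ : Fin n → ℤ) (z : Fin n → R) : (fun q => ((form N r r' ρ q : ℤ) : R)) ⬝ᵥ z
      = ∑ q ∈ Finset.univ.erase r, ρ q * red N r r' z q := by
  rw [form_dotProduct]
  simp only [red, mul_sub, Finset.sum_sub_distrib, Finset.mul_sum]
  congr 1
  · exact Finset.sum_congr rfl fun q _ => by push_cast; ring
  · simp [hrr.symm]

theorem exists_weights {T : Finset (Fin n)} {r r' : Fin n} (hr' : r' ∈ T)
    {z : Fin n → ℚ} (hz : ∃ q ∈ insert r T, z q ≠ 0) {t : ℤ} (ht : t ≠ 0) :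
    ∃ N₁ : ℕ, ∀ N : ℕ, N₁ ≤ N → ∃ k : Fin n → ℤ, k r' = t ∧ (∀ q ≠ r', k q = 1 ∨ k q = 2) ∧
      ∑ q ∈ T, (k q : ℚ) * red N r r' z q ≠ 0 := by
  by_cases h : ∃ q ∈ T, q ≠ r' ∧ z q ≠ 0
  · obtain ⟨q₀, hq₀, hq₀r, hzq⟩ := h
    refine ⟨1, fun N hN => ?_⟩
    have hred : red N r r' z q₀ ≠ 0 := by
      have : (N : ℚ) ≠ 0 := by positivity
      simp [red, hq₀r, hzq, this]
    let k : Fin n → ℤ := fun q => if q = r' then t else 1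
    by_cases h0 : ∑ q ∈ T, (k q : ℚ) * red N r r' z q = 0
    · let k' : Fin n → ℤ := fun q => k q + if q = q₀ then 1 else 0
      refine ⟨k', by simp [k', k, hq₀r.symm], ?_, ?_⟩
      · intro q hq
        by_cases hqq : q = q₀
        · subst hqq; right; simp [k', k, hq]
        · left; simp [k', k, hq, hqq]
      · have : ∀ q, (k' q : ℚ) * red N r r' z q
            = k q * red N r r' z q + if q = q₀ then red N r r' z q else 0 := by
          intro q
          by_cases hqq : q = q₀
          · subst hqq; simp [k']; ring
          · simp [k', hqq]
        simp only [this, Finset.sum_add_distrib, h0, zero_add]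
        simpa [hq₀] using hred
    · refine ⟨k, by simp [k], ?_, h0⟩
      intro q hq; left; simp [k, hq]
  · push Not at h
    have h' : z r' ≠ 0 ∨ z r ≠ 0 := by
      obtain ⟨q, hq, hzq⟩ := hz
      rcases Finset.mem_insert.1 hq with rfl | hq
      · exact Or.inr hzq
      · by_cases hqr : q = r'
        · subst hqr; exact Or.inl hzq
        · exact absurd (h q hq hqr) hzq
    obtain ⟨N₁, hN₁⟩ := eventually_mul_sub_ne h'
    refine ⟨N₁, fun N hN => ⟨fun q => if q = r' then t else 1, by simp, ?_, ?_⟩⟩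
    · intro q hq; left; simp [hq]
    · rw [Finset.sum_eq_single_of_mem r' hr']
      · have : (t : ℚ) ≠ 0 := by exact_mod_cast ht
        simpa [red, this] using hN₁ N hN
      · intro q hq hqr
        simp [red, hqr, h q hq hqr]

theorem State.exists_flag {c : ℝ} {A : Subgroup (SLZ n)} (h : State c A) (hc : 0 < c)
    (hc1 : c ≤ 1) {r r' : Fin n} (hrr : r ≠ r') :
    ∃ N₀ : ℕ, 2 ≤ N₀ ∧ ∀ N : ℕ, N₀ ≤ N → ∀ (ρ : Fin n → ℤ) (b : ℝ), 1 ≤ b →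
      (∀ q ≠ r, c * b ≤ |(ρ q : ℝ)| ∧ |(ρ q : ℝ)| ≤ b) →
      ∃ A', A ≤ A' ∧ State c A' ∧
        Flag A' (fun i => (dir N r r' i : ℚ)) (fun i => (form N r r' ρ i : ℚ)) := by
  obtain ⟨N₀, h2, H⟩ := h.step_exact hc hc1 hrr
  refine ⟨N₀, h2, fun N hN ρ b hb hρ => ?_⟩
  obtain ⟨M, hM, HM⟩ := H N hN
  exact ⟨_, le_sup_left, HM ρ b hb hρ, flag_of_tv_mem hM.ne'
    ((le_sup_right : _ ≤ A ⊔ _) (Subgroup.mem_zpowers _))⟩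

theorem State.exists_generic_flag {c : ℝ} {A : Subgroup (SLZ n)} (h : State c A) (hc : 0 < c)
    (hc1 : c ≤ 1 / 2) {r r' : Fin n} (hrr : r ≠ r') {z : Fin n → ℚ} (hz : z ≠ 0) :
    ∃ N₀ : ℕ, 2 ≤ N₀ ∧ ∀ N : ℕ, N₀ ≤ N → ∃ (A' : Subgroup (SLZ n)) (ρ : Fin n → ℤ),
      A ≤ A' ∧ State c A' ∧
        Flag A' (fun i => (dir N r r' i : ℚ)) (fun i => (form N r r' ρ i : ℚ)) ∧
        (fun i => (form N r r' ρ i : ℚ)) ⬝ᵥ z ≠ 0 := by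
  obtain ⟨N₀, h2, H⟩ := h.exists_flag hc (by linarith) hrr
  have hz' : ∃ q ∈ insert r (Finset.univ.erase r), z q ≠ 0 := by
    by_contra! hcon
    exact hz (funext fun q => hcon q (by simp))
  obtain ⟨N₁, H₁⟩ := exists_weights (T := Finset.univ.erase r) (r' := r')
    (by simp [hrr.symm]) hz' (t := 1) one_ne_zero
  refine ⟨max N₀ N₁, h2.trans (le_max_left _ _), fun N hN => ?_⟩
  obtain ⟨k, hk1, hk2, hk⟩ := H₁ N ((le_max_right _ _).trans hN)
  have hk3 : ∀ q, k q = 1 ∨ k q = 2 := by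
    intro q
    by_cases hq : q = r'
    · exact Or.inl (hq ▸ hk1)
    · exact hk2 q hq
  obtain ⟨A', hA', hs, hf⟩ := H N ((le_max_left _ _).trans hN) k 2 (by norm_num) (by
    intro q _
    rcases hk3 q with h | h <;> rw [h] <;> norm_num <;> linarith)
  refine ⟨A', k, hA', hs, hf, ?_⟩
  rw [form_dotProduct_red _ hrr]
  exact hk

theorem matQ_injective : Function.Injective (matQ : SLZ n → _) := by
  intro g h hgh
  apply Subtype.ext
  ext i j
  have := congrFun (congrFun hgh i) j
  simpa [matQ_apply] using this

/-- If every flag belongs to `A ⊔ ⟨h⟩`, then a conjugate of an elementary matrix by an element of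
`A ⊔ ⟨h⟩` can be added to `A`. -/
theorem State.add_elementary {c : ℝ} {A : Subgroup (SLZ n)} (hA : State c A) (hc : 0 < c)
    (hc1 : c ≤ 1) (h : SLZ n) (hfull : ∀ u, Full (A ⊔ Subgroup.zpowers h) u) {i j : Fin n}
    (hij : i ≠ j) (s : SLZ n) (hs : matQ s = 1 + vecMulVec (Pi.single i 1) (Pi.single j 1)) :
    ∃ A', A ≤ A' ∧ State c A' ∧ s ∈ A' ⊔ Subgroup.zpowers h := by
  obtain ⟨N, h2, H⟩ := hA.step hc hc1 hij.symm
  obtain ⟨α, hα, M₀, H⟩ := H N le_rfl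
  have hN0 : (2 : ℝ) ≤ N := by exact_mod_cast h2
  have hNpos : 0 < N := by omega
  set p := dir N j i with hp
  set ψ := form N j i 1 with hψ
  have hψp : ψ ⬝ᵥ p = 0 := form_dir N hij.symm 1
  have hψpQ : (fun q => (ψ q : ℚ)) ⬝ᵥ (fun q => (p q : ℚ)) = 0 := by
    have : ((ψ ⬝ᵥ p : ℤ) : ℚ) = 0 := by rw [hψp]; simp
    simpa [dotProduct] using this
  obtain ⟨m, hm, Hm⟩ := (hfull _ _ hψpQ).exists_pos
  obtain ⟨k, hk⟩ := exists_nat_gt (max (max M₀ 1) (1 / α))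
  obtain ⟨w, hw, hwm⟩ := Hm k
  have hkM : M₀ < k := ((le_max_left _ _).trans (le_max_left _ _)).trans_lt hk
  have hk1 : 1 < (k : ℝ) := ((le_max_right _ _).trans (le_max_left _ _)).trans_lt hk
  have hkα : 1 / α < k := (le_max_right _ _).trans_lt hk
  have hk0 : 0 < (k : ℤ) := by exact_mod_cast (lt_trans one_pos hk1)
  set l : ℤ := k * m * N with hl
  have hlk : (k : ℝ) ≤ l := by
    have : (k : ℤ) * 1 * 1 ≤ k * m * N := by gcongr <;> omega
    rw [mul_one, mul_one] at this
    exact_mod_cast this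
  have hl0 : (0 : ℝ) < l := by linarith
  have hpj : p j = N := by simp [hp, dir, hij.symm]
  have hpi : p i = 1 := by simp [hp, dir, hij]
  have hψj : ψ j = -1 := by simp [hψ, form]
  have hψq : ∀ q ≠ j, ψ q = N := by intro q hq; simp [hψ, form, hq]
  set v : Fin n → ℤ := Pi.single i 1 + l • p with hv
  set φ : Fin n → ℤ := Pi.single j 1 - l • ψ with hφ
  have hφv : φ ⬝ᵥ v = 0 := by
    have h1 : (Pi.single j 1 : Fin n → ℤ) ⬝ᵥ Pi.single i 1 = 0 := by simp [hij]
    have h2 : (Pi.single j 1 : Fin n → ℤ) ⬝ᵥ p = N := by simp [hpj]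
    have h3 : ψ ⬝ᵥ Pi.single i 1 = N := by simp [hψq i hij]
    rw [hφ, hv, sub_dotProduct, dotProduct_add, dotProduct_add, dotProduct_smul, dotProduct_smul,
      smul_dotProduct, smul_dotProduct, h1, h2, h3, hψp]
    simp
  have hvj : v j = l * N := by simp [hv, hpj, hij.symm]
  refine ⟨_, le_sup_left, H v φ hφv (l * N) (by positivity) ?_ ?_ ?_ ?_, ?_⟩
  · rw [hvj]
    have : (0 : ℝ) < l * N := by positivity
    exact_mod_cast this.ne'
  · intro q
    rw [hvj]
    have h1 : (1 : ℝ) ≤ α * |((l * N : ℤ) : ℝ)| := by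
      push_cast
      rw [abs_of_pos (by positivity)]
      rw [div_lt_iff₀ hα] at hkα
      calc (1 : ℝ) ≤ α * (k * 1) := by linarith
        _ ≤ _ := by gcongr; linarith
    have h3 : ((v q : ℤ) : ℝ) - ((l * N : ℤ) : ℝ) * tilt j i (1 / N) q =
        if q = i then 1 else 0 := by
      have : (N : ℝ) ≠ 0 := by positivity
      by_cases hqi : q = i
      · subst hqi
        simp [hv, hpi, tilt, hij]
        field_simp
        ring
      · by_cases hqj : q = j
        · subst hqj
          simp [hv, hpj, tilt, hqi]
        · simp [hv, hp, dir, tilt, hqi, hqj]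
    rw [h3]
    split_ifs
    · simpa using h1
    · simp; positivity
  · intro q hq
    have : φ q = -(l * N) := by simp [hφ, hψq q hq, hq]
    rw [this]
    push_cast
    rw [abs_neg, abs_of_pos (by positivity)]
    refine ⟨?_, le_rfl⟩
    have : (0 : ℝ) < l * N := by positivity
    nlinarith
  · rw [hvj]
    push_cast
    rw [abs_of_pos (by positivity)]
    have h1 : (l : ℝ) * 1 ≤ l * N := by gcongr; linarith
    nlinarith
  · set K := A ⊔ Subgroup.zpowers (tv v φ hφv) ⊔ Subgroup.zpowers h
    have hwK : w ∈ K := (sup_le_sup_right le_sup_left _ : A ⊔ Subgroup.zpowers h ≤ K) hw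
    have haK : tv v φ hφv ∈ K :=
      (le_sup_left : _ ≤ K) ((le_sup_right : _ ≤ A ⊔ _) (Subgroup.mem_zpowers _))
    have key : tv v φ hφv * w = w * s := by
      apply matQ_injective
      have hv' : (fun q => ((v q : ℤ) : ℚ)) = Pi.single i 1 + (l : ℚ) • (fun q => (p q : ℚ)) := by
        ext q
        simp [hv, Pi.single_apply]
      have hφ' : (fun q => ((φ q : ℤ) : ℚ)) = Pi.single j 1 - (l : ℚ) • (fun q => (ψ q : ℚ)) := by
        ext q
        simp [hφ, Pi.single_apply]
      have hl' : (l : ℚ) = ((k * m : ℤ) : ℚ) * N := by rw [hl]; push_cast; ring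
      have h4 : Pi.single j 1 ⬝ᵥ (fun q => (p q : ℚ)) = N := by simp [hpj]
      have h5 : (fun q => (ψ q : ℚ)) ⬝ᵥ Pi.single i 1 = N := by
        simp [hψq i hij]
      rw [matQ_mul, matQ_mul, matQ_tv, hwm, hs, hv', hφ', hl']
      simp only [mul_add, add_mul, mul_one, one_mul, vecMulVec_mul_vecMulVec, smul_mul_assoc,
        sub_mul, mul_smul_comm, vecMulVec_smul, smul_vecMulVec, vecMulVec_sub, add_vecMulVec, h4,
        h5, hψpQ]
      push_cast
      module
    have : s = w⁻¹ * tv v φ hφv * w := by rw [mul_assoc, key, inv_mul_cancel_left]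
    rw [this]
    exact mul_mem (mul_mem (inv_mem hwK) haK) hwK

/-- In some column of `h`, two entries are of size comparable to the norm of the column. -/
def Spread (ε : ℝ) (h : SLZ n) : Prop :=
  ∃ s a b, a ≠ b ∧ h.1 a s ≠ 0 ∧ (∀ q, |(h.1 q s : ℝ)| ≤ |(h.1 a s : ℝ)|) ∧
    ε * |(h.1 a s : ℝ)| ≤ |(h.1 b s : ℝ)|

/-- Weights adapted to a vector `x` with two comparable coordinates satisfy the window
conditions. -/
theorem window {x : Fin n → ℤ} {a b r : Fin n} (hra : r ≠ a) (hrb : r ≠ b) (hab : a ≠ b) {ε : ℝ}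
    (hε : 0 < ε) {t : ℤ} (ht2 : 2 ≤ t) (ht : (4 * n + 1) * (4 / ε) ≤ t) (hxa : x a ≠ 0)
    (hx : ∀ q, |(x q : ℝ)| ≤ 2 * |(x a : ℝ)|) (hxb : ε / 2 * |(x a : ℝ)| ≤ |(x b : ℝ)|) {N : ℕ}
    (hN : 8 / ε ≤ N) (hN2 : 2 ≤ N) {k : Fin n → ℤ} (hkb : k b = t)
    (hk : ∀ q ≠ b, k q = 1 ∨ k q = 2) {ρ : Fin n → ℤ}
    (hρ : ∀ q ≠ a, ρ q = k q * red N r b x a)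
    (hρa : ρ a = -∑ q ∈ (Finset.univ.erase r).erase a, k q * red N r b x q) (q : Fin n) :
    |((red N r b x a : ℤ) : ℝ)| ≤ |(ρ q : ℝ)| ∧
      |(ρ q : ℝ)| ≤ (4 * n + 3 * t) * |((red N r b x a : ℤ) : ℝ)| := by
  have ht2' : (2 : ℝ) ≤ t := by exact_mod_cast ht2
  have hN2' : (2 : ℝ) ≤ N := by exact_mod_cast hN2
  have hxa' : 0 < |(x a : ℝ)| := abs_pos.2 (by exact_mod_cast hxa)
  have hn : (0 : ℝ) ≤ n := by positivity
  have hX : ((red N r b x a : ℤ) : ℝ) = N * x a := by simp [red, hab]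
  set X := |((red N r b x a : ℤ) : ℝ)| with hXd
  have hXN : X = N * |(x a : ℝ)| := by rw [hXd, hX, abs_mul, abs_of_pos (by linarith)]
  have hX0 : 0 < X := by rw [hXN]; positivity
  have hN8 : 8 ≤ ε * N := by rw [div_le_iff₀ hε] at hN; linarith
  have ht' : (4 * n + 1) * 4 ≤ t * ε := by
    rw [← mul_div_assoc, div_le_iff₀ hε] at ht; linarith
  by_cases hqa : q = a
  · subst hqa
    have hbT : b ∈ (Finset.univ.erase r).erase q := by simp [hab.symm, hrb.symm]
    rw [hρa, ← Finset.add_sum_erase _ _ hbT, hkb]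
    set R : ℤ := ∑ p ∈ ((Finset.univ.erase r).erase q).erase b, k p * red N r b x p with hR
    have hRle : |(R : ℝ)| ≤ 4 * n * X := by
      rw [hR]
      push_cast
      refine (Finset.abs_sum_le_sum_abs _ _).trans ?_
      have : ∀ p ∈ ((Finset.univ.erase r).erase q).erase b,
          |((k p : ℤ) : ℝ) * (red N r b x p : ℤ)| ≤ 4 * X := by
        intro p hp
        have hpb := Finset.ne_of_mem_erase hp
        have h1 : ((red N r b x p : ℤ) : ℝ) = N * x p := by simp [red, hpb]
        have h2 : |((k p : ℤ) : ℝ)| ≤ 2 := by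
          rcases hk p hpb with h | h <;> rw [h] <;> norm_num
        rw [h1, abs_mul, abs_mul, abs_of_pos (a := (N : ℝ)) (by linarith), hXN]
        calc _ ≤ 2 * (N * (2 * |(x q : ℝ)|)) := by gcongr; exact hx p
          _ = _ := by ring
      refine (Finset.sum_le_card_nsmul _ _ _ this).trans ?_
      rw [nsmul_eq_mul]
      have hcard : ((((Finset.univ.erase r).erase q).erase b).card : ℝ) ≤ n := by
        have := Finset.card_le_univ (((Finset.univ.erase r).erase q).erase b)
        rw [Fintype.card_fin] at this
        exact_mod_cast this
      nlinarith
    have hxb' : ((red N r b x b : ℤ) : ℝ) = N * x b - x r := by simp [red]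
    have hNx : |(N : ℝ) * x b| = N * |(x b : ℝ)| := by rw [abs_mul, abs_of_pos (by linarith)]
    have hxr := hx r
    have hbup : |((red N r b x b : ℤ) : ℝ)| ≤ 3 * X := by
      rw [hxb', hXN]
      refine (abs_sub _ _).trans ?_
      rw [hNx]
      have := hx b
      nlinarith
    have hblow : ε / 4 * X ≤ |((red N r b x b : ℤ) : ℝ)| := by
      rw [hxb', hXN]
      refine le_trans ?_ (abs_sub_abs_le_abs_sub _ _)
      rw [hNx]
      nlinarith
    have e : ((-(t * red N r b x b + R) : ℤ) : ℝ) = -(t * (red N r b x b : ℤ) + R) := by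
      push_cast; ring
    rw [e, abs_neg]
    have habs : |(t : ℝ) * (red N r b x b : ℤ)| = t * |((red N r b x b : ℤ) : ℝ)| := by
      rw [abs_mul, abs_of_pos (by linarith)]
    constructor
    · have h1 := abs_sub_abs_le_abs_add ((t : ℝ) * (red N r b x b : ℤ)) R
      rw [habs] at h1
      have h2 : t * (ε / 4 * X) ≤ t * |((red N r b x b : ℤ) : ℝ)| := by gcongr
      nlinarith
    · refine (abs_add_le _ _).trans ?_
      rw [habs]
      nlinarith
  · rw [hρ q hqa]
    push_cast
    rw [abs_mul, ← hXd]
    have : 1 ≤ |(k q : ℝ)| ∧ |(k q : ℝ)| ≤ t := by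
      by_cases hqb : q = b
      · rw [hqb, hkb, abs_of_pos (by linarith)]
        exact ⟨by linarith, le_rfl⟩
      · rcases hk q hqb with h | h <;> rw [h] <;> norm_num <;> linarith
    constructor <;> nlinarith

theorem State.grow {c ε : ℝ} {t : ℤ} (hε : 0 < ε) (ht2 : 2 ≤ t)
    (ht : (4 * n + 1) * (4 / ε) ≤ t) (hc : c = 1 / (4 * n + 3 * t)) {A : Subgroup (SLZ n)}
    (hA : State c A) (h : SLZ n) {x : Fin n → ℤ} {a b r : Fin n} (hra : r ≠ a) (hrb : r ≠ b)
    (hab : a ≠ b) (hxa : x a ≠ 0) (hx : ∀ q, |(x q : ℝ)| ≤ 2 * |(x a : ℝ)|)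
    (hxb : ε / 2 * |(x a : ℝ)| ≤ |(x b : ℝ)|) {ψ : Fin n → ℚ}
    (hψ : Flag (A ⊔ Subgroup.zpowers h) (fun q => (x q : ℚ)) ψ) (hψr : ψ r ≠ 0)
    (hfull : ¬ Full (A ⊔ Subgroup.zpowers h) (fun q => (x q : ℚ))) :
    ∃ A', A ≤ A' ∧ State c A' ∧ formSpace (A ⊔ Subgroup.zpowers h) (fun q => (x q : ℚ))
      < formSpace (A' ⊔ Subgroup.zpowers h) (fun q => (x q : ℚ)) := by
  have ht2' : (2 : ℝ) ≤ t := by exact_mod_cast ht2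
  have hn : (0 : ℝ) ≤ n := by positivity
  have hcp : 0 < c := by rw [hc]; positivity
  have hc1 : c ≤ 1 := by rw [hc, div_le_one (by positivity)]; linarith
  simp only [Full, not_forall] at hfull
  obtain ⟨ψ₁, hψ₁x, hψ₁⟩ := hfull
  obtain ⟨χ, hχ, hχψ⟩ := exists_dotProduct_ne
    (S := formSpace (A ⊔ Subgroup.zpowers h) (fun q => (x q : ℚ))) hψ₁
  have hxaQ : (x a : ℚ) ≠ 0 := by exact_mod_cast hxa
  set z : Fin n → ℚ := χ - (χ a / x a) • (fun q => (x q : ℚ)) with hz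
  have hza : z a = 0 := by simp [hz, hxaQ]
  have hz0 : ∀ φ ∈ formSpace (A ⊔ Subgroup.zpowers h) (fun q => (x q : ℚ)), φ ⬝ᵥ z = 0 := by
    intro φ hφ
    rw [hz, dotProduct_sub, dotProduct_smul, hφ.1, dotProduct_comm, hχ φ hφ]
    simp
  have hzne : z ≠ 0 := by
    intro h0
    apply hχψ
    have : ψ₁ ⬝ᵥ z = 0 := by rw [h0, dotProduct_zero]
    rw [hz, dotProduct_sub, dotProduct_smul, hψ₁x, smul_zero, sub_zero] at this
    rw [dotProduct_comm, this]
  set T := (Finset.univ.erase r).erase a with hT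
  have hz' : ∃ q ∈ insert r T, z q ≠ 0 := by
    by_contra! hcon
    refine hzne (funext fun q => ?_)
    by_cases hqa : q = a
    · rw [hqa, hza]; rfl
    · refine hcon q ?_
      simp only [hT, Finset.mem_insert, Finset.mem_erase, Finset.mem_univ, and_true]
      tauto
  have hbT : b ∈ T := by simp [hT, hab.symm, hrb.symm]
  obtain ⟨N₁, H₁⟩ := exists_weights (r := r) hbT hz' (t := t) (by omega)
  obtain ⟨N₂, H₂⟩ := eventually_mul_sub_ne (x := ψ r) (y := -ψ b) (Or.inl hψr)
  obtain ⟨N₃, hN₃⟩ := exists_nat_ge (8 / ε)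
  obtain ⟨N₀, h2, H₀⟩ := hA.exists_flag hcp hc1 hrb
  set N := max (max N₀ N₁) (max N₂ N₃) with hN
  have hN0 : N₀ ≤ N := (le_max_left _ _).trans (le_max_left _ _)
  have hN1 : N₁ ≤ N := (le_max_right _ _).trans (le_max_left _ _)
  have hN2 : N₂ ≤ N := (le_max_left _ _).trans (le_max_right _ _)
  have hN3 : N₃ ≤ N := (le_max_right _ _).trans (le_max_right _ _)
  have hN8 : 8 / ε ≤ N := hN₃.trans (by exact_mod_cast hN3)
  obtain ⟨k, hkb, hk, hkz⟩ := H₁ N hN1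
  set ρ : Fin n → ℤ := fun q => if q = a then -∑ q ∈ T, k q * red N r b x q
    else k q * red N r b x a with hρ
  have hw := window hra hrb hab hε ht2 ht hxa hx hxb hN8 (h2.trans hN0) hkb hk (ρ := ρ)
    (fun q hq => by simp [hρ, hq]) (by simp [hρ, hT])
  have hXa : red N r b x a = N * x a := by simp [red, hab]
  have hXne : red N r b x a ≠ 0 := by
    rw [hXa]
    have : (N : ℤ) ≠ 0 := by omega
    exact mul_ne_zero this hxa
  have hX1 : (1 : ℝ) ≤ |((red N r b x a : ℤ) : ℝ)| := by exact_mod_cast Int.one_le_abs hXne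
  obtain ⟨A', hAA, hs, hf⟩ := H₀ N hN0 ρ ((4 * n + 3 * t) * |((red N r b x a : ℤ) : ℝ)|)
    (by nlinarith) (by
      intro q _
      refine ⟨?_, (hw q).2⟩
      rw [hc, ← mul_assoc, one_div, inv_mul_cancel₀ (by positivity), one_mul]
      exact (hw q).1)
  have haT : a ∈ Finset.univ.erase r := by simp [hra.symm]
  have hsum : ∀ y : Fin n → ℚ, (fun q => (form N r b ρ q : ℚ)) ⬝ᵥ y
      = (ρ a : ℚ) * red N r b y a + (red N r b x a : ℤ) * ∑ q ∈ T, (k q : ℚ) * red N r b y q := by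
    intro y
    rw [form_dotProduct_red _ hrb, ← Finset.add_sum_erase _ _ haT, Finset.mul_sum]
    congr 1
    refine Finset.sum_congr rfl fun q hq => ?_
    have : q ≠ a := Finset.ne_of_mem_erase hq
    simp only [hρ, this, if_false]
    push_cast
    ring
  have hredcast : ∀ q, red N r b (fun q => (x q : ℚ)) q = ((red N r b x q : ℤ) : ℚ) := by
    intro q; simp only [red]; push_cast; split_ifs <;> simp
  have hfx : (fun q => (form N r b ρ q : ℚ)) ⬝ᵥ (fun q => (x q : ℚ)) = 0 := by
    rw [hsum]
    simp only [hredcast, hρ, if_true]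
    push_cast
    ring
  have hfz : (fun q => (form N r b ρ q : ℚ)) ⬝ᵥ z ≠ 0 := by
    rw [hsum]
    have : red N r b z a = 0 := by simp [red, hab, hza]
    rw [this, mul_zero, zero_add]
    exact mul_ne_zero (by exact_mod_cast hXne) hkz
  have hle : A ⊔ Subgroup.zpowers h ≤ A' ⊔ Subgroup.zpowers h := sup_le_sup_right hAA _
  have hψd : ψ ⬝ᵥ (fun q => (dir N r b q : ℚ)) ≠ 0 := by
    rw [dotProduct_dir]
    have := H₂ N hN2
    rwa [sub_neg_eq_add] at this
  refine ⟨A', hAA, hs, lt_of_le_of_ne (fun φ hφ => Flag.mono hle hφ) fun heq => ?_⟩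
  refine hfz (hz0 _ ?_)
  rw [heq]
  exact (hψ.mono hle).commutator (hf.mono le_sup_left) hfx hψd

theorem State.exists_full {c ε : ℝ} {t : ℤ} (hε : 0 < ε) (ht2 : 2 ≤ t)
    (ht : (4 * n + 1) * (4 / ε) ≤ t) (hc : c = 1 / (4 * n + 3 * t)) {A : Subgroup (SLZ n)}
    (hA : State c A) (h : SLZ n) {x : Fin n → ℤ} {a b r : Fin n} (hra : r ≠ a) (hrb : r ≠ b)
    (hab : a ≠ b) (hxa : x a ≠ 0) (hx : ∀ q, |(x q : ℝ)| ≤ 2 * |(x a : ℝ)|)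
    (hxb : ε / 2 * |(x a : ℝ)| ≤ |(x b : ℝ)|) {ψ : Fin n → ℚ}
    (hψ : Flag (A ⊔ Subgroup.zpowers h) (fun q => (x q : ℚ)) ψ) (hψr : ψ r ≠ 0) :
    ∃ A', A ≤ A' ∧ State c A' ∧ Full (A' ⊔ Subgroup.zpowers h) (fun q => (x q : ℚ)) := by
  induction hS : formSpace (A ⊔ Subgroup.zpowers h) (fun q => (x q : ℚ)) using
    WellFoundedGT.induction generalizing A with
  | ind S ih =>
    by_cases hf : Full (A ⊔ Subgroup.zpowers h) (fun q => (x q : ℚ))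
    · exact ⟨A, le_rfl, hA, hf⟩
    · obtain ⟨A', hAA, hs, hlt⟩ := hA.grow hε ht2 ht hc h hra hrb hab hxa hx hxb hψ hψr hf
      obtain ⟨A'', h1, h2, h3⟩ := ih _ (hS ▸ hlt) hs
        (hψ.mono (sup_le_sup_right hAA _)) rfl
      exact ⟨A'', hAA.trans h1, h2, h3⟩

theorem State.exists_full_all (hn : 3 ≤ n) {c : ℝ} {A : Subgroup (SLZ n)} (hA : State c A)
    (hc : 0 < c) (hc1 : c ≤ 1 / 2) (h : SLZ n) {x : Fin n → ℚ} (hx : x ≠ 0)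
    (hfull : Full (A ⊔ Subgroup.zpowers h) x) :
    ∃ A', A ≤ A' ∧ State c A' ∧ ∀ u, Full (A' ⊔ Subgroup.zpowers h) u := by
  have key : ∀ S : Finset (Fin n), ∃ A', A ≤ A' ∧ State c A' ∧ ∀ i ∈ S, ∃ (N : ℕ) (j : Fin n),
      2 ≤ N ∧ (fun q => (dir N i j q : ℚ)) ∈
        Submodule.span ℚ {u | Full (A' ⊔ Subgroup.zpowers h) u} := by
    intro S
    induction S using Finset.induction_on with
    | empty => exact ⟨A, le_rfl, hA, by simp⟩
    | insert i S _ ih =>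
      obtain ⟨A', hAA, hs, hS⟩ := ih
      have : Nontrivial (Fin n) := Fin.nontrivial_iff_two_le.2 (by omega)
      obtain ⟨j, hj⟩ := exists_ne i
      obtain ⟨N, h2, H⟩ := hs.exists_generic_flag hc hc1 hj.symm hx
      obtain ⟨A'', ρ, hAA', hs', hf, hfx⟩ := H N le_rfl
      have hle := sup_le_sup_right hAA' (Subgroup.zpowers h)
      refine ⟨A'', hAA.trans hAA', hs', ?_⟩
      intro i' hi'
      rcases Finset.mem_insert.1 hi' with rfl | hi'
      · refine ⟨N, j, h2, ?_⟩
        have hfx' : Full (A'' ⊔ Subgroup.zpowers h) x :=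
          hfull.mono (sup_le_sup_right (hAA.trans hAA') _)
        obtain ⟨-, m, hm, g, hg, hgm⟩ := hf
        have h3 := hfx'.conj ((le_sup_left : A'' ≤ A'' ⊔ Subgroup.zpowers h) hg)
        have h4 := Submodule.sub_mem _ (Submodule.subset_span (R := ℚ)
            (s := {u | Full (A'' ⊔ Subgroup.zpowers h) u}) h3)
          (Submodule.subset_span (R := ℚ) (s := {u | Full (A'' ⊔ Subgroup.zpowers h) u}) hfx')
        rw [hgm, add_mulVec, one_mulVec, add_sub_cancel_left, smul_mulVec, vecMulVec_mulVec] at h4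
        have h5 := Submodule.smul_mem _ (m * ((fun q => (form N i' j ρ q : ℚ)) ⬝ᵥ x))⁻¹ h4
        convert h5 using 1
        ext q
        simp only [Pi.smul_apply, MulOpposite.smul_eq_mul_unop, MulOpposite.unop_op, smul_eq_mul]
        field_simp
      · obtain ⟨N', j', h2', h3⟩ := hS i' hi'
        exact ⟨N', j', h2', Submodule.span_mono (fun u hu => Full.mono hle hu) h3⟩
  obtain ⟨A', hAA, hs, H⟩ := key Finset.univ
  refine ⟨A', hAA, hs, full_of_span hn ?_⟩
  by_contra hne
  obtain ⟨z, -, hz⟩ := SetLike.exists_of_lt (lt_top_iff_ne_top.2 hne)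
  obtain ⟨χ, hχ, hχz⟩ := exists_dotProduct_ne hz
  have : Nonempty (Fin n) := ⟨⟨0, by omega⟩⟩
  obtain ⟨i, hi⟩ := Finite.exists_max (fun i => |χ i|)
  obtain ⟨N, j, h2, hmem⟩ := H i (Finset.mem_univ i)
  have h3 := hχ _ hmem
  rw [dotProduct_dir] at h3
  have h4 : (N : ℚ) * |χ i| = |χ j| := by
    have : χ j = -(N * χ i) := by push_cast at h3; linarith
    rw [this, abs_neg, abs_mul, Nat.abs_cast]
  have h5 : (2 : ℚ) ≤ N := by exact_mod_cast h2
  have h6 : |χ i| = 0 := by nlinarith [hi j, abs_nonneg (χ i)]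
  have h7 : χ = 0 := by
    ext q
    have := hi q
    rw [h6] at this
    simpa using abs_nonpos_iff.1 this
  rw [h7, zero_dotProduct] at hχz
  exact hχz rfl

theorem State.exists_first_flag (hn : 3 ≤ n) {c ε : ℝ} (hε : 0 < ε) (hε1 : ε ≤ 1)
    {A : Subgroup (SLZ n)} (hA : State c A)
    (hc : 0 < c) (hc1 : c ≤ 1 / 2) {h : SLZ n} (hh : Spread ε h) :
    ∃ A', A ≤ A' ∧ State c A' ∧ ∃ (x : Fin n → ℤ) (a b r : Fin n) (ψ : Fin n → ℚ),
      r ≠ a ∧ r ≠ b ∧ a ≠ b ∧ x a ≠ 0 ∧ (∀ q, |(x q : ℝ)| ≤ 2 * |(x a : ℝ)|) ∧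
      ε / 2 * |(x a : ℝ)| ≤ |(x b : ℝ)| ∧
      Flag (A' ⊔ Subgroup.zpowers h) (fun q => (x q : ℚ)) ψ ∧ ψ r ≠ 0 := by
  obtain ⟨s, a, b, hab, ha0, hmax, hb⟩ := hh
  have : Nontrivial (Fin n) := Fin.nontrivial_iff_two_le.2 (by omega)
  obtain ⟨s', hs'⟩ := exists_ne s
  obtain ⟨r, hr⟩ : ∃ r, r ∉ ({a, b} : Finset (Fin n)) := by
    by_contra! hcon
    have h1 : (Finset.univ : Finset (Fin n)) ⊆ {a, b} := fun q _ => hcon q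
    have h2 := Finset.card_le_card h1
    have h3 : ({a, b} : Finset (Fin n)).card ≤ 2 := Finset.card_le_two
    rw [Finset.card_univ, Fintype.card_fin] at h2
    omega
  simp only [Finset.mem_insert, Finset.mem_singleton, not_or] at hr
  set z : Fin n → ℚ := matQ h⁻¹ *ᵥ Pi.single r 1 with hz
  have hz0 : z ≠ 0 := by
    intro h0
    have : matQ h *ᵥ z = Pi.single r 1 := by
      rw [hz, mulVec_mulVec, ← matQ_mul, mul_inv_cancel, matQ_one, one_mulVec]
    rw [h0, mulVec_zero] at this
    simpa using congrFun this r
  obtain ⟨N₀, h2, H⟩ := hA.exists_generic_flag hc hc1 hs'.symm hz0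
  obtain ⟨B, hB⟩ : ∃ B : ℝ, ∀ q, |(h.1 q s' : ℝ)| ≤ B := by
    obtain ⟨i, hi⟩ := Finite.exists_max (fun q => |(h.1 q s' : ℝ)|)
    exact ⟨_, hi⟩
  have hB0 : 0 ≤ B := (abs_nonneg _).trans (hB s)
  obtain ⟨N₁, hN₁⟩ := exists_nat_ge (4 * B / ε)
  set N := max N₀ N₁
  have hN1 : 4 * B / ε ≤ N := hN₁.trans (by exact_mod_cast le_max_right _ _)
  have hN0 : (2 : ℝ) ≤ N := by exact_mod_cast h2.trans (le_max_left _ _)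
  obtain ⟨A', ρ, hAA, hs, hf, hfz⟩ := H N (le_max_left _ _)
  set x : Fin n → ℤ := h.1 *ᵥ dir N s s' with hx
  have hxq : ∀ q, x q = N * h.1 q s + h.1 q s' := by
    intro q
    have := dotProduct_dir (h.1 q) N s s'
    simpa [hx, mulVec] using this
  have hha : (1 : ℝ) ≤ |(h.1 a s : ℝ)| := by exact_mod_cast Int.one_le_abs ha0
  set M := (N : ℝ) * |(h.1 a s : ℝ)| with hM
  have hMB : B ≤ ε / 4 * M := by
    rw [div_le_iff₀ hε] at hN1
    have : (N : ℝ) * 1 ≤ M := by rw [hM]; gcongr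
    nlinarith
  have hM0 : 0 < M := by positivity
  have hxR : ∀ q, ((x q : ℤ) : ℝ) = N * h.1 q s + h.1 q s' := by
    intro q; rw [hxq]; push_cast; ring
  have hNabs : ∀ q, |(N : ℝ) * h.1 q s| = N * |(h.1 q s : ℝ)| := by
    intro q; rw [abs_mul, Nat.abs_cast]
  have hup : ∀ q, |((x q : ℤ) : ℝ)| ≤ 5 / 4 * M := by
    intro q
    rw [hxR]
    refine (abs_add_le _ _).trans ?_
    rw [hNabs]
    have h3 : (N : ℝ) * |(h.1 q s : ℝ)| ≤ M := by
      rw [hM]; exact mul_le_mul_of_nonneg_left (hmax q) (by linarith)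
    have := hB q
    nlinarith
  have hlow : ∀ q, (N : ℝ) * |(h.1 q s : ℝ)| - ε / 4 * M ≤ |((x q : ℤ) : ℝ)| := by
    intro q
    rw [hxR]
    have := abs_sub_abs_le_abs_add ((N : ℝ) * h.1 q s) (h.1 q s')
    rw [hNabs] at this
    have := hB q
    linarith
  have hla := hlow a
  have hlb := hlow b
  rw [← hM] at hla
  have hNb : ε * M ≤ N * |(h.1 b s : ℝ)| := by
    rw [hM]
    calc ε * (N * |(h.1 a s : ℝ)|) = N * (ε * |(h.1 a s : ℝ)|) := by ring
      _ ≤ _ := by gcongr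
  have hεM : ε * M ≤ M := by nlinarith
  refine ⟨A', hAA, hs, x, a, b, r, (fun q => (form N s s' ρ q : ℚ)) ᵥ* matQ h⁻¹, hr.1, hr.2, hab,
    ?_, ?_, ?_, ?_, ?_⟩
  · intro h0
    rw [h0] at hla
    simp at hla
    linarith
  · intro q
    have := hup q
    linarith
  · have := hup a
    nlinarith
  · have := (hf.mono le_sup_left).conj
      ((le_sup_right : _ ≤ A' ⊔ _) (Subgroup.mem_zpowers h))
    convert this using 1
    ext q
    rw [hxq, mulVec, dotProduct_dir]
    push_cast
    rfl
  · have : ((fun q => (form N s s' ρ q : ℚ)) ᵥ* matQ h⁻¹) r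
        = (fun q => (form N s s' ρ q : ℚ)) ⬝ᵥ z := by
      rw [hz, dotProduct_mulVec, dotProduct_single, mul_one]
    rw [this]
    exact hfz

/-- A state can be enlarged so that, together with a given spread element, it generates a
given elementary matrix. -/
theorem exists_constant (hn : 3 ≤ n) {ε : ℝ} (hε : 0 < ε) (hε1 : ε ≤ 1) :
    ∃ c > 0, ∀ (A : Subgroup (SLZ n)) (h s : SLZ n) (i j : Fin n), State c A → Spread ε h → i ≠ j →
      matQ s = 1 + vecMulVec (Pi.single i 1) (Pi.single j 1) →
      ∃ A', A ≤ A' ∧ State c A' ∧ s ∈ A' ⊔ Subgroup.zpowers h := by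
  obtain ⟨t₀, ht₀⟩ := exists_nat_ge ((4 * n + 1) * (4 / ε))
  set t : ℤ := max t₀ 2
  have ht2 : 2 ≤ t := le_max_right _ _
  have ht : (4 * n + 1) * (4 / ε) ≤ t :=
    ht₀.trans (by
      rw [← Int.cast_natCast (R := ℝ)]
      exact Int.cast_le.2 (le_max_left _ _))
  have ht2' : (2 : ℝ) ≤ t := by exact_mod_cast ht2
  have hn0 : (0 : ℝ) ≤ n := by positivity
  set c : ℝ := 1 / (4 * n + 3 * t) with hc
  have hc0 : 0 < c := by positivity
  have hc1 : c ≤ 1 / 2 := by rw [hc]; gcongr; linarith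
  refine ⟨c, hc0, fun A h s i j hA hh hij hs => ?_⟩
  obtain ⟨A₁, hAA₁, hs₁, x, a, b, r, ψ, hra, hrb, hab, hxa, hx, hxb, hψ, hψr⟩ :=
    hA.exists_first_flag hn hε hε1 hc0 hc1 hh
  obtain ⟨A₂, hAA₂, hs₂, hfull⟩ := hs₁.exists_full hε ht2 ht hc h hra hrb hab hxa hx hxb hψ hψr
  obtain ⟨A₃, hAA₃, hs₃, hfull'⟩ := hs₂.exists_full_all hn hc0 hc1 h
    (fun h0 => hxa (by simpa using congrFun h0 a)) hfull
  obtain ⟨A₄, hAA₄, hs₄, hmem⟩ := hs₃.add_elementary hc0 (by linarith) h hfull' hij s hs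
  exact ⟨A₄, ((hAA₁.trans hAA₂).trans hAA₃).trans hAA₄, hs₄, hmem⟩

/-- The elementary matrix `1 + c E_{ij}`. -/
abbrev elem {i j : Fin n} (hij : i ≠ j) (c : ℤ) : SLZ n :=
  Matrix.SpecialLinearGroup.transvection hij c

theorem elem_mul_same {i j : Fin n} (hij : i ≠ j) (c : ℤ) (s : SLZ n) (q : Fin n) :
    (elem hij c * s).1 i q = s.1 i q + c * s.1 j q :=
  Matrix.transvection_mul_apply_same i j q c s.1

theorem elem_mul_of_ne {i j p : Fin n} (hij : i ≠ j) (hp : p ≠ i) (c : ℤ) (s : SLZ n)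
    (q : Fin n) : (elem hij c * s).1 p q = s.1 p q :=
  Matrix.transvection_mul_apply_of_ne i j p q hp c s.1

theorem mul_apply_eq_sum (g h : SLZ n) (i j : Fin n) :
    (g * h).1 i j = ∑ q, g.1 i q * h.1 q j :=
  mul_apply

theorem one_coe_apply (i j : Fin n) :
    (1 : SLZ n).1 i j = (1 : Matrix (Fin n) (Fin n) ℤ) i j :=
  rfl

/-- The columns of `s` with index in `S` are those of the identity. -/
def FixCols (S : Finset (Fin n)) (s : SLZ n) : Prop :=
  ∀ q ∈ S, ∀ p, s.1 p q = (1 : Matrix (Fin n) (Fin n) ℤ) p q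

theorem FixCols.elem_mul {S : Finset (Fin n)} {s : SLZ n} (hs : FixCols S s) {i j : Fin n}
    (hij : i ≠ j) (hj : j ∉ S) (c : ℤ) : FixCols S (elem hij c * s) := by
  intro q hq p
  by_cases hp : p = i
  · subst hp
    rw [elem_mul_same, hs q hq, hs q hq, one_apply_ne (i := j), mul_zero, add_zero]
    rintro rfl; exact hj hq
  · rw [elem_mul_of_ne hij hp, hs q hq]

theorem elem_mem {E : Subgroup (SLZ n)} {i j : Fin n} {hij : i ≠ j} (h : elem hij 1 ∈ E) (c : ℤ) :
    elem hij c ∈ E := by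
  induction c using Int.induction_on with
  | zero => rw [elem, SpecialLinearGroup.transvection_coeff_zero]; exact E.one_mem
  | succ k ih => rw [elem, SpecialLinearGroup.transvection_add]; exact mul_mem ih h
  | pred k ih =>
    rw [elem, sub_eq_add_neg, SpecialLinearGroup.transvection_add]
    refine mul_mem ih ?_
    rw [← SpecialLinearGroup.transvection_inv]
    exact inv_mem h

theorem exists_reduced_col {E : Subgroup (SLZ n)}
    (hE : ∀ (i j : Fin n) (hij : i ≠ j), elem hij 1 ∈ E)
    {S : Finset (Fin n)} {i : Fin n} {s : SLZ n} (hs : FixCols S s) :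
    ∃ e ∈ E, FixCols S (e * s) ∧ ∀ p ∉ S, ∀ q ∉ S, p ≠ q →
      (e * s).1 p i = 0 ∨ (e * s).1 q i = 0 := by
  induction hm : ∑ q ∈ Sᶜ, (s.1 q i).natAbs using Nat.strong_induction_on generalizing s with
  | _ m ih =>
    by_cases hred : ∀ p ∉ S, ∀ q ∉ S, p ≠ q → s.1 p i = 0 ∨ s.1 q i = 0
    · exact ⟨1, E.one_mem, by simpa using hs, by simpa using hred⟩
    have : ∃ p ∉ S, ∃ q ∉ S, p ≠ q ∧ s.1 p i ≠ 0 ∧ s.1 q i ≠ 0 ∧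
        (s.1 p i).natAbs ≤ (s.1 q i).natAbs := by
      push Not at hred
      obtain ⟨p, hp, q, hq, hpq, h1, h2⟩ := hred
      rcases le_total (s.1 p i).natAbs (s.1 q i).natAbs with h | h
      · exact ⟨p, hp, q, hq, hpq, h1, h2, h⟩
      · exact ⟨q, hq, p, hp, hpq.symm, h2, h1, h⟩
    obtain ⟨p, hp, q, hq, hpq, h1, h2, hle⟩ := this
    obtain ⟨c, hc⟩ : ∃ c : ℤ, (s.1 q i + c * s.1 p i).natAbs < (s.1 q i).natAbs := by
      rcases lt_or_gt_of_ne h1 with h3 | h3 <;> rcases lt_or_gt_of_ne h2 with h4 | h4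
      · exact ⟨-1, by omega⟩
      · exact ⟨1, by omega⟩
      · exact ⟨1, by omega⟩
      · exact ⟨-1, by omega⟩
    have hlt : ∑ r ∈ Sᶜ, ((elem hpq.symm c * s).1 r i).natAbs < m := by
      rw [← hm]
      refine Finset.sum_lt_sum (fun r _ => ?_) ⟨q, by simpa using hq, ?_⟩
      · by_cases hr : r = q
        · subst hr; rw [elem_mul_same]; exact hc.le
        · rw [elem_mul_of_ne _ hr]
      · rw [elem_mul_same]; exact hc
    obtain ⟨e, he, h5, h6⟩ := ih _ hlt (hs.elem_mul hpq.symm hp c) rfl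
    refine ⟨e * elem hpq.symm c, mul_mem he (elem_mem (hE _ _ _) c), ?_, ?_⟩ <;>
      rw [mul_assoc] <;> assumption

theorem exists_clear_col {E : Subgroup (SLZ n)}
    (hE : ∀ (i j : Fin n) (hij : i ≠ j), elem hij 1 ∈ E)
    {S T : Finset (Fin n)} {i : Fin n} (hi : i ∉ S) (hT : i ∉ T) {s : SLZ n}
    (hs : FixCols S s) (h1 : s.1 i i = 1) :
    ∃ e ∈ E, FixCols S (e * s) ∧ (e * s).1 i i = 1 ∧ ∀ q ∈ T, (e * s).1 q i = 0 := by
  induction T using Finset.induction_on with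
  | empty => exact ⟨1, E.one_mem, by simpa using hs, by simpa using h1, by simp⟩
  | insert r T hr ih =>
    simp only [Finset.mem_insert, not_or] at hT
    obtain ⟨e, he, h2, h3, h4⟩ := ih hT.2
    have hri : r ≠ i := Ne.symm hT.1
    refine ⟨elem hri (-(e * s).1 r i) * e, mul_mem (elem_mem (hE _ _ _) _) he, ?_, ?_, ?_⟩
    · rw [mul_assoc]; exact h2.elem_mul hri hi _
    · rw [mul_assoc, elem_mul_of_ne _ hT.1, h3]
    · intro q hq
      rw [mul_assoc]
      rcases Finset.mem_insert.1 hq with rfl | hq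
      · rw [elem_mul_same, h3]; ring
      · rw [elem_mul_of_ne hri (fun h => hr (h ▸ hq)), h4 q hq]

theorem exists_unit_col {E : Subgroup (SLZ n)}
    (hE : ∀ (i j : Fin n) (hij : i ≠ j), elem hij 1 ∈ E)
    {S : Finset (Fin n)} {i : Fin n} (hi : i ∉ S) {s : SLZ n}
    (hs : FixCols S s) : ∃ e ∈ E, FixCols S (e * s) ∧ (e * s).1 i i = 1 := by
  obtain ⟨e, he, hf, hr⟩ := exists_reduced_col hE (i := i) hs
  suffices ∃ e' ∈ E, FixCols S (e' * (e * s)) ∧ (e' * (e * s)).1 i i = 1 by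
    obtain ⟨e', he', h⟩ := this
    exact ⟨e' * e, mul_mem he' he, by simpa only [mul_assoc] using h⟩
  generalize e * s = s at hf hr
  have hinv : ∀ q ∈ S, s⁻¹.1 i q = 0 := by
    intro q hq
    have h1 : (s⁻¹ * s).1 i q = s⁻¹.1 i q := by
      rw [mul_apply_eq_sum, Finset.sum_eq_single q]
      · rw [hf q hq, one_apply_eq, mul_one]
      · intro p _ hp
        rw [hf q hq, one_apply_ne hp, mul_zero]
      · simp
    rw [← h1, inv_mul_cancel, one_coe_apply, one_apply_ne]
    rintro rfl; exact hi hq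
  have hsum : ∑ q, s⁻¹.1 i q * s.1 q i = 1 := by
    have : (s⁻¹ * s).1 i i = 1 := by rw [inv_mul_cancel, one_coe_apply, one_apply_eq]
    rwa [mul_apply_eq_sum] at this
  obtain ⟨b, -, hb⟩ := Finset.exists_ne_zero_of_sum_ne_zero (hsum.trans_ne one_ne_zero)
  have hbS : b ∉ S := fun h => hb (by rw [hinv b h, zero_mul])
  have hb0 : s.1 b i ≠ 0 := right_ne_zero_of_mul hb
  have hother : ∀ q ∉ S, q ≠ b → s.1 q i = 0 := fun q hq hqb =>
    (hr q hq b hbS hqb).resolve_right hb0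
  rw [Finset.sum_eq_single b] at hsum
  rotate_left
  · intro q _ hqb
    by_cases hq : q ∈ S
    · rw [hinv q hq, zero_mul]
    · rw [hother q hq hqb, mul_zero]
  · simp
  have hu : s.1 b i = 1 ∨ s.1 b i = -1 := by
    rw [mul_comm] at hsum
    exact Int.eq_one_or_neg_one_of_mul_eq_one hsum
  by_cases hbi : b = i
  · subst hbi
    rcases hu with hu | hu
    · exact ⟨1, E.one_mem, by simpa using hf, by simpa using hu⟩
    by_cases hj : ∃ j ∉ S, j ≠ b
    · obtain ⟨j, hjS, hjb⟩ := hj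
      refine ⟨elem hjb.symm (-2) * elem hjb 1,
        mul_mem (elem_mem (hE _ _ _) _) (hE _ _ _), ?_, ?_⟩
      · rw [mul_assoc]; exact (hf.elem_mul hjb hbS _).elem_mul _ hjS _
      · rw [mul_assoc, elem_mul_same, elem_mul_of_ne _ hjb.symm, elem_mul_same, hu,
          hother j hjS hjb]
        norm_num
    · push Not at hj
      exfalso
      have h1 : s.1 = (1 : Matrix (Fin n) (Fin n) ℤ).updateCol b (fun p => s.1 p b) := by
        ext p q
        by_cases hq : q = b
        · subst hq; simp
        · rw [updateCol_ne hq]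
          exact hf q (by by_contra h; exact hq (hj q h)) p
      have h2 : s.1.det = s.1 b b := by
        conv_lhs => rw [h1]
        rw [← cramer_apply, cramer_one]
        rfl
      rw [s.2, hu] at h2
      norm_num at h2
  · refine ⟨elem (Ne.symm hbi) (s.1 b i), elem_mem (hE _ _ _) _, hf.elem_mul _ hbS _, ?_⟩
    rw [elem_mul_same, hother i hi (Ne.symm hbi)]
    rcases hu with hu | hu <;> rw [hu] <;> norm_num

/-- `SL(n,ℤ)` is generated by the elementary matrices. -/
theorem eq_top_of_elem_mem {E : Subgroup (SLZ n)}
    (hE : ∀ (i j : Fin n) (hij : i ≠ j), elem hij 1 ∈ E) : E = ⊤ := by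
  have key : ∀ (S : Finset (Fin n)) (s : SLZ n), ∃ e ∈ E, FixCols S (e * s) := by
    intro S
    induction S using Finset.induction_on with
    | empty => exact fun s => ⟨1, E.one_mem, by simp [FixCols]⟩
    | insert i S hi ih =>
      intro s
      obtain ⟨e, he, hs⟩ := ih s
      obtain ⟨e', he', hs', h1⟩ := exists_unit_col hE hi hs
      obtain ⟨e'', he'', hs'', h2, h3⟩ := exists_clear_col hE (T := Finset.univ.erase i) hi
        (by simp) hs' h1
      refine ⟨e'' * e' * e, mul_mem (mul_mem he'' he') he, ?_⟩
      intro q hq p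
      rw [mul_assoc, mul_assoc]
      rcases Finset.mem_insert.1 hq with rfl | hq
      · by_cases hp : p = q
        · rw [hp, h2, one_apply_eq]
        · rw [h3 p (by simp [hp]), one_apply_ne hp]
      · exact hs'' q hq p
  rw [eq_top_iff]
  intro s _
  obtain ⟨e, he, hs⟩ := key Finset.univ s
  have : e * s = 1 := Subtype.ext (Matrix.ext fun p q => hs q (Finset.mem_univ q) p)
  rw [eq_inv_of_mul_eq_one_right this]
  exact inv_mem he

theorem matQ_elem {i j : Fin n} (hij : i ≠ j) :
    matQ (elem hij 1) = 1 + vecMulVec (Pi.single i 1) (Pi.single j 1) := by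
  ext p q
  rw [matQ_apply]
  change (((1 : Matrix (Fin n) (Fin n) ℤ) p q + Matrix.single i j (1 : ℤ) p q : ℤ) : ℚ) = _
  rw [Matrix.add_apply, vecMulVec_apply, Matrix.single_apply, Matrix.one_apply, Matrix.one_apply]
  by_cases hp : p = i
  · by_cases hq : q = j
    · subst hp hq; simp [hij]
    · simp [hp, hq, Ne.symm hq]
  · simp [hp, Ne.symm hp]

instance : Countable (SLZ n) :=
  inferInstanceAs (Countable {f : Fin n → Fin n → ℤ // Matrix.det (Matrix.of f) = 1})

theorem State.mulVec_single_mem {c : ℝ} {A : Subgroup (SLZ n)} (hA : State c A) (i : Fin n)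
    {a : SLZ n} (ha : a ∈ A) : matR a *ᵥ Pi.single i 1 ∈ nearAxis n (1 / 2) := by
  obtain ⟨Y, η, κ, h⟩ := hA
  have key : ∀ θ : ℝ, 0 ≤ θ → (Pi.single i 1 : Fin n → ℝ) ∈ nearAxis n θ := fun θ hθ =>
    ⟨i, by simp, fun q hq => by simpa [hq] using hθ⟩
  rcases h.move a ha _ (key η h.eta_pos.le) with h1 | h1
  · rw [h1]; exact key _ (by norm_num)
  · exact h.sub h1

/-- There is a subgroup `A` of `SL(n,ℤ)` moving the basis vectors into a proper region, and
generating everything together with any single `ε`-spread element. -/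
theorem exists_subgroup (hn : 3 ≤ n) {ε : ℝ} (hε : 0 < ε) (hε1 : ε ≤ 1) :
    ∃ A : Subgroup (SLZ n), (∀ h, Spread ε h → A ⊔ Subgroup.zpowers h = ⊤) ∧
      ∀ a ∈ A, ∀ i, matR a *ᵥ Pi.single i 1 ∈ nearAxis n (1 / 2) := by
  obtain ⟨c, -, hc⟩ := exists_constant hn hε hε1
  have step : ∀ (A : {A : Subgroup (SLZ n) // State c A}) (t : SLZ n × Fin n × Fin n),
      ∃ A' : {A : Subgroup (SLZ n) // State c A}, A.1 ≤ A'.1 ∧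
        (Spread ε t.1 → ∀ hij : t.2.1 ≠ t.2.2, elem hij 1 ∈ A'.1 ⊔ Subgroup.zpowers t.1) := by
    intro A t
    by_cases h : Spread ε t.1 ∧ t.2.1 ≠ t.2.2
    · obtain ⟨A', h1, h2, h3⟩ := hc A.1 t.1 (elem h.2 1) t.2.1 t.2.2 A.2 h.1 h.2 (matQ_elem h.2)
      exact ⟨⟨A', h2⟩, h1, fun _ _ => h3⟩
    · exact ⟨A, le_rfl, fun h1 h2 => absurd ⟨h1, h2⟩ h⟩
  choose next hle hmem using step
  have : Nonempty (Fin n) := ⟨⟨0, by omega⟩⟩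
  obtain ⟨e, he⟩ := exists_surjective_nat (SLZ n × Fin n × Fin n)
  let f : ℕ → {A : Subgroup (SLZ n) // State c A} :=
    fun k => Nat.rec ⟨⊥, state_bot c⟩ (fun m A => next A (e m)) k
  have hmono : Monotone fun k => (f k).1 := monotone_nat_of_le_succ fun k => hle (f k) (e k)
  refine ⟨⨆ k, (f k).1, fun h hh => ?_, fun a ha i => ?_⟩
  · refine eq_top_of_elem_mem fun i j hij => ?_
    obtain ⟨k, hk⟩ := he (h, i, j)
    have h1 := hmem (f k) (e k)
    rw [hk] at h1
    have h2 : elem hij 1 ∈ (next (f k) (h, i, j)).1 ⊔ Subgroup.zpowers h := h1 hh hij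
    have h3 : next (f k) (h, i, j) = f (k + 1) := by rw [← hk]
    rw [h3] at h2
    exact sup_le_sup_right (le_iSup (fun k => (f k).1) (k + 1)) _ h2
  · obtain ⟨k, hk⟩ := (Subgroup.mem_iSup_of_directed hmono.directed_le).1 ha
    exact (f k).2.mulVec_single_mem i hk

/-- There is a positive matrix in `SL(n,ℤ)` whose row sums are pairwise distinct. -/
theorem exists_positive (hn : 0 < n) : ∃ g : SLZ n, (∀ k r, 0 < g.1 k r) ∧
    Function.Injective fun k => ∑ r, g.1 k r := by
  let L : Matrix (Fin n) (Fin n) ℤ := fun i j => if j ≤ i then 1 else 0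
  have hL : L.det = 1 := by
    rw [det_of_isLowerTriangular L fun i j hij => if_neg (not_le.2 hij)]
    exact Finset.prod_eq_one fun i _ => if_pos le_rfl
  have h0 : ∀ i j, 0 ≤ L i j := fun i j => by
    change 0 ≤ if j ≤ i then (1 : ℤ) else 0
    split_ifs <;> norm_num
  have hmono : ∀ i i' j, i ≤ i' → L i j ≤ L i' j := fun i i' j hii => by
    change (if j ≤ i then (1 : ℤ) else 0) ≤ if j ≤ i' then (1 : ℤ) else 0
    split_ifs with h1 h2
    · exact le_rfl
    · exact absurd (h1.trans hii) h2
    · exact zero_le_one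
    · exact le_rfl
  have hg : ∀ k r, (L * Lᵀ) k r = ∑ j, L k j * L r j := fun k r => mul_apply
  refine ⟨⟨L * Lᵀ, by rw [det_mul, det_transpose, hL, one_mul]⟩, fun k r => ?_, ?_⟩
  · change 0 < (L * Lᵀ) k r
    rw [hg]
    refine Finset.sum_pos' (fun j _ => mul_nonneg (h0 _ _) (h0 _ _))
      ⟨⟨0, hn⟩, Finset.mem_univ _, ?_⟩
    have : ∀ i, L i ⟨0, hn⟩ = 1 := fun i => if_pos (Fin.mk_le_of_le_val (Nat.zero_le _))
    rw [this, this]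
    norm_num
  · have hlt : StrictMono fun k => ∑ r, (L * Lᵀ) k r := by
      intro k k' hk
      refine Finset.sum_lt_sum (fun r _ => ?_) ⟨k', Finset.mem_univ _, ?_⟩
      · rw [hg, hg]
        exact Finset.sum_le_sum fun j _ => mul_le_mul_of_nonneg_right (hmono _ _ _ hk.le) (h0 _ _)
      · rw [hg, hg]
        refine Finset.sum_lt_sum (fun j _ =>
          mul_le_mul_of_nonneg_right (hmono _ _ _ hk.le) (h0 _ _)) ⟨k', Finset.mem_univ _, ?_⟩
        have h1 : L k k' = 0 := if_neg (not_le.2 hk)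
        have h2 : L k' k' = 1 := if_pos le_rfl
        rw [h1, h2]
        norm_num
    exact hlt.injective

theorem exists_ne_zero_in_col (h : SLZ n) (s : Fin n) : ∃ q, h.1 q s ≠ 0 := by
  by_contra! hk
  have : (h⁻¹ * h).1 s s = 0 := by
    rw [mul_apply_eq_sum]
    exact Finset.sum_eq_zero fun q _ => by rw [hk q, mul_zero]
  rw [inv_mul_cancel, one_coe_apply, one_apply_eq] at this
  exact one_ne_zero this

/-- A matrix in `SL(n,ℤ)` with at most one nonzero entry in each column is a signed permutation
matrix. -/
theorem exists_signed_perm {h : SLZ n} (hm : ∀ s a b, a ≠ b → h.1 a s = 0 ∨ h.1 b s = 0) :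
    ∃ (σ : Fin n → Fin n) (c : Fin n → ℤ), Function.Injective σ ∧ (∀ k, |c k| = 1) ∧
      ∀ q k, h.1 q k = if q = σ k then c k else 0 := by
  choose σ hσ using exists_ne_zero_in_col h
  have h2 : ∀ q k, q ≠ σ k → h.1 q k = 0 := fun q k hq => (hm k q (σ k) hq).resolve_right (hσ k)
  have h3 : ∀ p k, (1 : Matrix (Fin n) (Fin n) ℤ) p k = h⁻¹.1 p (σ k) * h.1 (σ k) k := by
    intro p k
    rw [← one_coe_apply, ← inv_mul_cancel h, mul_apply_eq_sum, Finset.sum_eq_single (σ k)]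
    · intro q _ hq
      rw [h2 q k hq, mul_zero]
    · simp
  refine ⟨σ, fun k => h.1 (σ k) k, fun k k' hk => ?_, fun k => ?_, fun q k => ?_⟩
  · by_contra hne
    have h4 := h3 k k'
    have h5 := h3 k k
    rw [one_apply_ne hne, ← hk] at h4
    rw [one_apply_eq] at h5
    rcases mul_eq_zero.1 h4.symm with h6 | h6
    · rw [h6, zero_mul] at h5
      exact one_ne_zero h5
    · rw [hk] at h6
      exact hσ k' h6
  · have h5 := h3 k k
    rw [one_apply_eq, mul_comm] at h5
    exact Int.isUnit_iff_abs_eq.1 (IsUnit.of_mul_eq_one _ h5.symm)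
  · split_ifs with hq
    · rw [hq]
    · exact h2 q k hq

theorem mem_center_of_monomial {g h h' : SLZ n} (hpos : ∀ k r, 0 < g.1 k r)
    (hinj : Function.Injective fun k => ∑ r, g.1 k r) (hgh : h * g = g * h')
    (hm : ∀ s a b, a ≠ b → h.1 a s = 0 ∨ h.1 b s = 0)
    (hm' : ∀ s a b, a ≠ b → h'.1 a s = 0 ∨ h'.1 b s = 0) : h ∈ Subgroup.center (SLZ n) := by
  obtain ⟨σ, c, hσ, hc, hh⟩ := exists_signed_perm hm
  obtain ⟨τ, d, hτ, hd, hh'⟩ := exists_signed_perm hm'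
  have h1 : ∀ k r, c k * g.1 k r = g.1 (σ k) (τ r) * d r := by
    intro k r
    have h2 : (h * g).1 (σ k) r = c k * g.1 k r := by
      rw [mul_apply_eq_sum, Finset.sum_eq_single k]
      · rw [hh, if_pos rfl]
      · intro q _ hq
        rw [hh, if_neg fun h => hq (hσ h.symm), zero_mul]
      · simp
    have h3 : (g * h').1 (σ k) r = g.1 (σ k) (τ r) * d r := by
      rw [mul_apply_eq_sum, Finset.sum_eq_single (τ r)]
      · rw [hh', if_pos rfl]
      · intro q _ hq
        rw [hh', if_neg hq, mul_zero]
      · simp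
    rw [← h2, hgh, h3]
  have h2 : ∀ k r, g.1 k r = g.1 (σ k) (τ r) := by
    intro k r
    have := congrArg abs (h1 k r)
    rwa [abs_mul, abs_mul, hc, hd, one_mul, mul_one, abs_of_pos (hpos _ _),
      abs_of_pos (hpos _ _)] at this
  have h3 : ∀ k, σ k = k := by
    intro k
    refine hinj (?_ : ∑ r, g.1 (σ k) r = ∑ r, g.1 k r)
    rw [Finset.sum_congr rfl fun r _ => h2 k r]
    exact (Function.Bijective.sum_comp (Finite.injective_iff_bijective.1 hτ)
      (fun r => g.1 (σ k) r)).symm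
  have h4 : ∀ k r, c k = d r := by
    intro k r
    have := h1 k r
    rw [← h2, mul_comm] at this
    exact mul_left_cancel₀ (hpos k r).ne' this
  rw [Subgroup.mem_center_iff]
  intro x
  ext p q
  rw [mul_apply_eq_sum, mul_apply_eq_sum, Finset.sum_eq_single q, Finset.sum_eq_single p]
  · rw [hh, hh, h3, h3, if_pos rfl, if_pos rfl, h4 q p, h4 p p, mul_comm]
  · intro k _ hk
    rw [hh, h3, if_neg hk.symm, zero_mul]
  · simp
  · intro k _ hk
    rw [hh, h3, if_neg hk, mul_zero]
  · simp

/-- The columns of a matrix that is not `ε`-spread have at most one large entry. -/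
theorem small_of_not_spread {ε H : ℝ} {h : SLZ n} (hε : 0 ≤ ε) (hs : ¬ Spread ε h)
    (hH : ∀ p q, |(h.1 p q : ℝ)| ≤ H) {s a b : Fin n} (hab : a ≠ b) :
    |(h.1 a s : ℝ)| ≤ ε * H ∨ |(h.1 b s : ℝ)| ≤ ε * H := by
  have : Nonempty (Fin n) := ⟨s⟩
  obtain ⟨t, ht⟩ := Finite.exists_max fun q => |(h.1 q s : ℝ)|
  have key : ∀ u, u ≠ t → |(h.1 u s : ℝ)| ≤ ε * H := by
    intro u hu
    by_contra! hlt
    have hlt' : ε * |(h.1 t s : ℝ)| < |(h.1 u s : ℝ)| :=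
      (mul_le_mul_of_nonneg_left (hH t s) hε).trans_lt hlt
    refine hs ⟨s, t, u, hu.symm, fun h0 => ?_, ht, hlt'.le⟩
    have := ht u
    simp only [h0, Int.cast_zero, abs_zero, mul_zero] at this hlt'
    exact absurd hlt' (not_lt.2 this)
  by_cases ha : a = t
  · exact Or.inr (key b fun hb => hab (ha.trans hb.symm))
  · exact Or.inl (key a ha)

theorem abs_le_abs_sum_add {f : Fin n → ℝ} {p : Fin n} {B : ℝ} (hB : 0 ≤ B)
    (hf : ∀ k, k ≠ p → |f k| ≤ B) : |f p| ≤ |∑ k, f k| + n * B := by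
  have h1 : f p = ∑ k, f k - ∑ k ∈ Finset.univ.erase p, f k := by
    rw [← Finset.add_sum_erase _ _ (Finset.mem_univ p)]; ring
  have h2 : |∑ k ∈ Finset.univ.erase p, f k| ≤ n * B := by
    refine (Finset.abs_sum_le_sum_abs _ _).trans
      ((Finset.sum_le_card_nsmul _ _ B fun k hk => hf k (Finset.ne_of_mem_erase hk)).trans ?_)
    rw [nsmul_eq_mul]
    refine mul_le_mul_of_nonneg_right ?_ hB
    exact_mod_cast (Finset.card_le_univ _).trans (Fintype.card_fin n).le
  rw [h1]
  calc |∑ k, f k - ∑ k ∈ Finset.univ.erase p, f k| ≤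
      |∑ k, f k| + |∑ k ∈ Finset.univ.erase p, f k| := abs_sub _ _
    _ ≤ _ := by linarith

theorem cast_mul_apply (g h : SLZ n) (p q : Fin n) :
    ((g * h).1 p q : ℝ) = ∑ k, (g.1 p k : ℝ) * (h.1 k q : ℝ) := by
  rw [mul_apply_eq_sum]; push_cast; rfl

theorem abs_mul_apply_le {g h : SLZ n} {X Y : ℝ} {p q : Fin n} (hg : ∀ k, |(g.1 p k : ℝ)| ≤ X)
    (hh : ∀ k, |(h.1 k q : ℝ)| ≤ Y) : |((g * h).1 p q : ℝ)| ≤ n * (X * Y) := by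
  rw [cast_mul_apply]
  refine (Finset.abs_sum_le_sum_abs _ _).trans ((Finset.sum_le_card_nsmul _ _ (X * Y)
    fun k _ => ?_).trans ?_)
  · rw [abs_mul]
    exact mul_le_mul (hg k) (hh k) (abs_nonneg _) ((abs_nonneg _).trans (hg k))
  · simp

theorem exists_large_in_row {g h h' : SLZ n} (hgh : h * g = g * h') (hpos : ∀ k r, 0 < g.1 k r)
    {K ε : ℝ} (hK : ∀ p q, |(g.1 p q : ℝ)| ≤ K) (hε : 0 ≤ ε) (hKε : n * (K * ε) ≤ 1 / 2)
    {t r : Fin n} (hother : ∀ u, u ≠ t → |(h'.1 u r : ℝ)| ≤ ε * |(h'.1 t r : ℝ)|) (p : Fin n) :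
    ∃ k, |(h'.1 t r : ℝ)| ≤ 2 * n * K * |(h.1 p k : ℝ)| := by
  have : Nonempty (Fin n) := ⟨p⟩
  have hK0 : 0 ≤ K := (abs_nonneg _).trans (hK p p)
  obtain ⟨k, hk⟩ := Finite.exists_max fun q => |(h.1 p q : ℝ)|
  refine ⟨k, ?_⟩
  have h1 : |(g.1 p t : ℝ) * (h'.1 t r : ℝ)| ≤ |((g * h').1 p r : ℝ)| +
      n * (K * (ε * |(h'.1 t r : ℝ)|)) := by
    rw [cast_mul_apply]
    refine abs_le_abs_sum_add (f := fun k => (g.1 p k : ℝ) * (h'.1 k r : ℝ))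
      (mul_nonneg hK0 (mul_nonneg hε (abs_nonneg _))) fun u hu => ?_
    rw [abs_mul]
    exact mul_le_mul (hK p u) (hother u hu) (abs_nonneg _) hK0
  have h2 : |((g * h').1 p r : ℝ)| ≤ n * (|(h.1 p k : ℝ)| * K) := by
    rw [← hgh]
    exact abs_mul_apply_le hk fun q => hK q r
  have h3 : (1 : ℝ) ≤ |(g.1 p t : ℝ)| := by
    rw [← Int.cast_abs]
    exact_mod_cast Int.one_le_abs (hpos p t).ne'
  have h4 : |(h'.1 t r : ℝ)| ≤ |(g.1 p t : ℝ) * (h'.1 t r : ℝ)| := by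
    rw [abs_mul]
    exact le_mul_of_one_le_left (abs_nonneg _) h3
  have h5 : n * (K * (ε * |(h'.1 t r : ℝ)|)) ≤ 1 / 2 * |(h'.1 t r : ℝ)| := by
    calc n * (K * (ε * |(h'.1 t r : ℝ)|)) = n * (K * ε) * |(h'.1 t r : ℝ)| := by ring
      _ ≤ _ := mul_le_mul_of_nonneg_right hKε (abs_nonneg _)
  nlinarith

theorem norm_bound {h : SLZ n} (hn : 0 < n) {ε c H : ℝ} (hH : 0 < H) (hε : 0 ≤ ε)
    (hεc : n * ε < c) (hrow : ∀ p, ∃ k, c * H ≤ |(h.1 p k : ℝ)|)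
    (hsmall : ∀ s a b, a ≠ b → |(h.1 a s : ℝ)| ≤ ε * H ∨ |(h.1 b s : ℝ)| ≤ ε * H) :
    (c - n * ε) * H ≤ 1 := by
  have hlt : ε * H < c * H := by
    refine mul_lt_mul_of_pos_right (lt_of_le_of_lt ?_ hεc) hH
    exact le_mul_of_one_le_left hε (by exact_mod_cast hn)
  have hεH : 0 ≤ ε * H := mul_nonneg hε hH.le
  choose π hπ using hrow
  have hinj : Function.Injective π := by
    intro p p' hp
    by_contra hne
    rcases hsmall (π p) p p' hne with h1 | h1
    · exact absurd ((hπ p).trans h1) (not_le.2 hlt)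
    · rw [hp] at h1
      exact absurd ((hπ p').trans h1) (not_le.2 hlt)
  have hsurj := Finite.surjective_of_injective hinj
  let s : Fin n := ⟨0, hn⟩
  have : Nonempty (Fin n) := ⟨s⟩
  obtain ⟨p₀, hp₀⟩ := Finite.exists_max fun q => |(h⁻¹.1 q s : ℝ)|
  obtain ⟨p, rfl⟩ := hsurj p₀
  have hX : (1 : ℝ) ≤ |(h⁻¹.1 (π p) s : ℝ)| := by
    obtain ⟨q, hq⟩ := exists_ne_zero_in_col h⁻¹ s
    refine le_trans ?_ (hp₀ q)
    rw [← Int.cast_abs]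
    exact_mod_cast Int.one_le_abs hq
  have h1 : |(h.1 p (π p) : ℝ) * (h⁻¹.1 (π p) s : ℝ)| ≤ |((h * h⁻¹).1 p s : ℝ)| +
      n * (ε * H * |(h⁻¹.1 (π p) s : ℝ)|) := by
    rw [cast_mul_apply]
    refine abs_le_abs_sum_add (f := fun k => (h.1 p k : ℝ) * (h⁻¹.1 k s : ℝ))
      (mul_nonneg hεH (abs_nonneg _)) fun k hk => ?_
    obtain ⟨p', rfl⟩ := hsurj k
    have hpp : p ≠ p' := fun h => hk (by rw [h])
    have h2 : |(h.1 p (π p') : ℝ)| ≤ ε * H := by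
      refine (hsmall (π p') p p' hpp).resolve_right fun h3 => ?_
      exact absurd ((hπ p').trans h3) (not_le.2 hlt)
    rw [abs_mul]
    exact mul_le_mul h2 (hp₀ _) (abs_nonneg _) hεH
  have h2 : |((h * h⁻¹).1 p s : ℝ)| ≤ 1 := by
    rw [mul_inv_cancel, one_coe_apply, one_apply]
    split_ifs <;> simp
  have h3 : c * H * |(h⁻¹.1 (π p) s : ℝ)| ≤ |(h.1 p (π p) : ℝ) * (h⁻¹.1 (π p) s : ℝ)| := by
    rw [abs_mul]
    exact mul_le_mul_of_nonneg_right (hπ p) (abs_nonneg _)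
  have h4 : (c - n * ε) * H * |(h⁻¹.1 (π p) s : ℝ)| ≤ 1 := by linarith
  exact (le_mul_of_one_le_right (mul_nonneg (by linarith) hH.le) hX).trans h4

theorem monomial_of_small {h : SLZ n} {ε H : ℝ} (hεH : ε * H < 1)
    (hsmall : ∀ s a b, a ≠ b → |(h.1 a s : ℝ)| ≤ ε * H ∨ |(h.1 b s : ℝ)| ≤ ε * H) (s a b : Fin n)
    (hab : a ≠ b) : h.1 a s = 0 ∨ h.1 b s = 0 := by
  have key : ∀ z : ℤ, |(z : ℝ)| ≤ ε * H → z = 0 := fun z hz => by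
    have h1 := hz.trans_lt hεH
    rw [← Int.cast_abs] at h1
    exact Int.abs_lt_one_iff.1 (by exact_mod_cast h1)
  exact (hsmall s a b hab).imp (key _) (key _)

theorem exists_max_entry (hn : 0 < n) (h : SLZ n) :
    ∃ t r, 0 < |(h.1 t r : ℝ)| ∧ ∀ p q, |(h.1 p q : ℝ)| ≤ |(h.1 t r : ℝ)| := by
  have : Nonempty (Fin n × Fin n) := ⟨⟨⟨0, hn⟩, ⟨0, hn⟩⟩⟩
  obtain ⟨⟨t, r⟩, htr⟩ := Finite.exists_max fun q : Fin n × Fin n => |(h.1 q.1 q.2 : ℝ)|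
  refine ⟨t, r, ?_, fun p q => htr (p, q)⟩
  obtain ⟨q, hq⟩ := exists_ne_zero_in_col h r
  exact (abs_pos.2 (Int.cast_ne_zero.2 hq)).trans_le (htr (q, r))

/-- For a suitable `g` and `ε`, every noncentral element has an `ε`-spread conjugate by `1` or
`g`. -/
theorem exists_conjugator (hn : 0 < n) : ∃ (g : SLZ n) (ε : ℝ), 0 < ε ∧ ε ≤ 1 ∧
    ∀ h, h ∉ Subgroup.center (SLZ n) → Spread ε h ∨ Spread ε (g⁻¹ * h * g) := by
  obtain ⟨g, hpos, hinj⟩ := exists_positive hn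
  obtain ⟨K, hK1, hK, hK'⟩ : ∃ K : ℝ, 1 ≤ K ∧ (∀ p q, |(g.1 p q : ℝ)| ≤ K) ∧
      ∀ p q, |(g⁻¹.1 p q : ℝ)| ≤ K := by
    obtain ⟨t, r, -, h1⟩ := exists_max_entry hn g
    obtain ⟨t', r', -, h2⟩ := exists_max_entry hn g⁻¹
    exact ⟨max 1 (max _ _), le_max_left _ _,
      fun p q => (h1 p q).trans ((le_max_left _ _).trans (le_max_right _ _)),
      fun p q => (h2 p q).trans ((le_max_right _ _).trans (le_max_right _ _))⟩
  have hn1 : (1 : ℝ) ≤ n := by exact_mod_cast hn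
  have hn0 : (0 : ℝ) < n := by linarith
  have hK0 : 0 < K := by linarith
  obtain ⟨c, hc⟩ : ∃ c : ℝ, c = 1 / (2 * n ^ 3 * K ^ 3) := ⟨_, rfl⟩
  have hc0 : 0 < c := by rw [hc]; positivity
  have hc1 : c ≤ 1 := by
    rw [hc, div_le_one (by positivity)]
    have h1 := one_le_pow₀ hn1 (n := 3)
    have h2 := one_le_pow₀ hK1 (n := 3)
    nlinarith
  obtain ⟨ε, hε⟩ : ∃ ε : ℝ, ε = c / (8 * n * K) := ⟨_, rfl⟩
  have hε0 : 0 < ε := by rw [hε]; positivity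
  have hεc : ε * n * K = c / 8 := by rw [hε]; field_simp
  have hnε : n * ε ≤ c / 8 := by
    rw [← hεc]; nlinarith [mul_pos hε0 hn0]
  refine ⟨g, ε, hε0, by nlinarith, fun h hh => ?_⟩
  by_contra! hcon
  obtain ⟨hs, hs'⟩ := hcon
  refine hh ?_
  obtain ⟨h', hh'⟩ : ∃ h', h' = g⁻¹ * h * g := ⟨_, rfl⟩
  rw [← hh'] at hs'
  have hgh : h * g = g * h' := by rw [hh']; group
  obtain ⟨a, b, hH0, hH⟩ := exists_max_entry hn h
  obtain ⟨t, r, hH0', hH'⟩ := exists_max_entry hn h'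
  have hsm := fun s a b hab => small_of_not_spread hε0.le hs hH (s := s) (a := a) (b := b) hab
  have hsm' := fun s a b hab => small_of_not_spread hε0.le hs' hH' (s := s) (a := a) (b := b) hab
  have hrow := exists_large_in_row (r := r) (t := t) hgh hpos hK hε0.le (by linarith) fun u hu =>
    (hsm' r u t hu).resolve_right fun h1 => by nlinarith
  have hcomp : |(h.1 a b : ℝ)| ≤ n * (n * (K * |(h'.1 t r : ℝ)|) * K) := by
    have h1 : h = g * h' * g⁻¹ := by rw [← hgh]; group
    conv_lhs => rw [h1]
    exact abs_mul_apply_le (fun k => abs_mul_apply_le (hK a) fun q => hH' q k) fun k => hK' k b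
  set H := |(h.1 a b : ℝ)|
  set H' := |(h'.1 t r : ℝ)|
  have hbound : (c - n * ε) * H ≤ 1 := by
    refine norm_bound hn hH0 hε0.le (by linarith) (fun p => ?_) hsm
    obtain ⟨k, hk⟩ := hrow p
    refine ⟨k, ?_⟩
    rw [hc, div_mul_eq_mul_div, div_le_iff₀ (by positivity), one_mul]
    calc H ≤ n ^ 2 * K ^ 2 * H' := hcomp.trans_eq (by ring)
      _ ≤ n ^ 2 * K ^ 2 * (2 * n * K * |(h.1 p k : ℝ)|) :=
        mul_le_mul_of_nonneg_left hk (by positivity)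
      _ = _ := by ring
  have hH'H : H' ≤ 2 * n * K * H := by
    obtain ⟨k, hk⟩ := hrow a
    exact hk.trans (mul_le_mul_of_nonneg_left (hH a k) (by positivity))
  have hcH : c * H ≤ 8 / 7 := by nlinarith
  have hεH' : ε * H' < 1 := by
    calc ε * H' ≤ ε * (2 * n * K * H) := mul_le_mul_of_nonneg_left hH'H hε0.le
      _ = 2 * (ε * n * K) * H := by ring
      _ = (c * H) / 4 := by rw [hεc]; ring
      _ < 1 := by linarith
  have hεH : ε * H < 1 := by nlinarith
  exact mem_center_of_monomial hpos hinj hgh (monomial_of_small hεH hsm)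
    (monomial_of_small hεH' hsm')

theorem elem_col {i j : Fin n} (hij : i ≠ j) (q : Fin n) :
    (elem hij 1).1 q j = if q = i ∨ q = j then 1 else 0 := by
  change (1 : Matrix (Fin n) (Fin n) ℤ) q j + Matrix.single i j (1 : ℤ) q j = _
  rw [Matrix.single_apply, Matrix.one_apply]
  by_cases hp : q = i
  · subst hp; simp [hij]
  · simp [hp, Ne.symm hp]

theorem spread_elem {ε : ℝ} (hε1 : ε ≤ 1) {i j : Fin n} (hij : i ≠ j) :
    Spread ε (elem hij 1) := by
  refine ⟨j, j, i, hij.symm, ?_, fun q => ?_, ?_⟩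
  · rw [elem_col]; simp
  · rw [elem_col, elem_col]; split_ifs <;> simp_all
  · rw [elem_col, elem_col]; simpa using hε1

theorem elem_ne_mul_center {i j : Fin n} (hij : i ≠ j) {a z : SLZ n}
    (ha : matR a *ᵥ Pi.single j 1 ∈ nearAxis n (1 / 2)) (hz : z ∈ Subgroup.center (SLZ n)) :
    elem hij 1 ≠ a * z := by
  intro h
  obtain ⟨r, -, hr⟩ := Matrix.SpecialLinearGroup.mem_center_iff.1 hz
  have h1 : ∀ q, (elem hij 1).1 q j = a.1 q j * r := by
    intro q
    rw [h]
    change (a.1 * z.1) q j = _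
    rw [← hr, scalar_apply, mul_diagonal]
  obtain ⟨p, -, hp⟩ := ha
  have h2 : ∀ q, q ≠ p → |((elem hij 1).1 q j : ℝ)| ≤ 1 / 2 * |((elem hij 1).1 p j : ℝ)| := by
    intro q hq
    have h3 := hp q hq
    rw [mulVec_single_one, col_apply, col_apply, matR_apply, matR_apply] at h3
    rw [h1, h1, Int.cast_mul, Int.cast_mul, abs_mul, abs_mul, ← mul_assoc]
    exact mul_le_mul_of_nonneg_right h3 (abs_nonneg _)
  have h3 : |((elem hij 1).1 p j : ℝ)| ≤ 1 := by
    rw [elem_col]; split_ifs <;> simp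
  obtain ⟨q, hq, hqp⟩ : ∃ q, (q = i ∨ q = j) ∧ q ≠ p := by
    by_cases hi : i = p
    · exact ⟨j, Or.inr rfl, fun hj => hij (hi.trans hj.symm)⟩
    · exact ⟨i, Or.inl rfl, hi⟩
  have h4 := h2 q hqp
  rw [elem_col hij q, if_pos hq] at h4
  norm_num at h4
  linarith

theorem infinite_PSLZ {i j : Fin n} (hij : i ≠ j) : Infinite (PSLZ n) := by
  refine Infinite.of_injective (fun k : ℤ => (elem hij k : PSLZ n)) fun k l hkl => ?_
  have h1 := QuotientGroup.eq.1 hkl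
  rw [elem, elem, SpecialLinearGroup.transvection_inv, ← SpecialLinearGroup.transvection_add,
    SpecialLinearGroup.transvection_mem_center_iff] at h1
  omega

end PingPong

open PingPong

/-- Theorem 3 (Gelander–Meiri): for `n ≥ 3` there exist an infinite-index maximal
subgroup `M` of `PSL(n,ℤ)` and `g ∈ PSL(n,ℤ)` with `M ∩ gMg⁻¹ = {id}`. -/
theorem exists_maximal_subgroup_trivial_conj_intersection (n : ℕ) (hn : 3 ≤ n) :
    ∃ (M : Subgroup (PSLZ n)) (g : PSLZ n), IsMaxSubgroup M ∧ M.index = 0 ∧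
      M ⊓ Subgroup.map (MulAut.conj g).toMonoidHom M = ⊥ := by
  obtain ⟨g, ε, hε, hε1, hg⟩ := exists_conjugator (n := n) (by omega)
  obtain ⟨A, hA, hA'⟩ := exists_subgroup hn hε hε1
  have hij : (⟨1, by omega⟩ : Fin n) ≠ ⟨0, by omega⟩ := by simp
  let π : SLZ n →* PSLZ n := QuotientGroup.mk' _
  have hπ : Function.Surjective π := QuotientGroup.mk'_surjective _
  have htop : ∀ (K : Subgroup (PSLZ n)) (h : SLZ n), A.map π ≤ K → Spread ε h → π h ∈ K →
      K = ⊤ := by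
    intro K h hK hs hh
    have h1 : A ⊔ Subgroup.zpowers h ≤ K.comap π :=
      sup_le (Subgroup.map_le_iff_le_comap.1 hK) (Subgroup.zpowers_le.2 hh)
    rw [hA h hs, top_le_iff] at h1
    rw [← Subgroup.map_comap_eq_self_of_surjective hπ K, h1, Subgroup.map_top_of_surjective π hπ]
  have hmem : π (elem hij 1) ∉ A.map π := by
    rintro ⟨a, ha, hae⟩
    exact elem_ne_mul_center hij (hA' a ha _) (QuotientGroup.eq.1 hae) (by group)
  obtain ⟨M, hAM, hM⟩ := zorn_le_nonempty₀
    {K : Subgroup (PSLZ n) | A.map π ≤ K ∧ π (elem hij 1) ∉ K} (by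
      intro C hC hchain K hK
      refine ⟨sSup C, ⟨(hC hK).1.trans (le_sSup hK), fun hmem => ?_⟩, fun L hL => le_sSup hL⟩
      obtain ⟨L, hL, hmem⟩ := (Subgroup.mem_sSup_of_directedOn ⟨K, hK⟩ hchain.directedOn).1 hmem
      exact (hC hL).2 hmem) (A.map π) ⟨le_rfl, hmem⟩
  have hne : M ≠ ⊤ := fun h => hM.prop.2 (h ▸ Subgroup.mem_top _)
  have hinter : M ⊓ Subgroup.map (MulAut.conj (π g)).toMonoidHom M = ⊥ := by
    rw [eq_bot_iff]
    rintro x ⟨hx, m, hm, hmx⟩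
    obtain ⟨h, rfl⟩ := hπ x
    by_contra hx1
    have hh : h ∉ Subgroup.center (SLZ n) := fun hc => hx1 ((QuotientGroup.eq_one_iff h).2 hc)
    have hm' : m = π (g⁻¹ * h * g) := by
      rw [map_mul, map_mul, map_inv, ← hmx]
      change m = (π g)⁻¹ * (π g * m * (π g)⁻¹) * π g
      group
    rcases hg h hh with hs | hs
    · exact hne (htop M h hAM hs hx)
    · exact hne (htop M _ hAM hs (hm' ▸ hm))
  refine ⟨M, π g, ⟨hne, fun K hK => ?_⟩, ?_, hinter⟩
  · by_contra hK'
    refine hK.not_ge (hM.le_of_ge ⟨hAM.trans hK.le, fun h => hK' ?_⟩ hK.le)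
    exact htop K _ (hAM.trans hK.le) (spread_elem hε1 hij) h
  · by_contra hindex
    have h1 := Subgroup.index_inf_ne_zero hindex
      (K := Subgroup.map (MulAut.conj (π g)).toMonoidHom M) (by
        rwa [show (Subgroup.map (MulAut.conj (π g)).toMonoidHom M).index = M.index from
          Subgroup.index_map_equiv M (MulAut.conj (π g))])
    rw [hinter, Subgroup.index_bot] at h1
    have := infinite_PSLZ hij
    exact h1 Nat.card_eq_zero_of_infinite
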